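/- arXiv:2306.10784 — 2 statements merged into one kernel-verified Lean document; each statement's English description precedes it below -/
import Mathlib

section
/- Every 4-dicritical oriented graph on n vertices has at least (10/3 + 1/51)n − 1 arcs. -/
/-- A (finite) digraph on vertices drawn from `ℕ`. -/
structure Dgr where
  verts : Finset ℕ
  Adj : ℕ → ℕ → Prop
  adj_mem : ∀ ⦃u v : ℕ⦄, Adj u v → u ∈ verts ∧ v ∈ verts
  adj_irrefl : ∀ v, ¬ Adj v v

namespace Dgr

/-- number of vertices -/
def nV (D : Dgr) : ℕ := D.verts.card

/-- number of arcs -/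
noncomputable def nA (D : Dgr) : ℕ := {p : ℕ × ℕ | D.Adj p.1 p.2}.ncard

/-- subdigraph relation -/
def Subd (H D : Dgr) : Prop := H.verts ⊆ D.verts ∧ ∀ ⦃u v : ℕ⦄, H.Adj u v → D.Adj u v

def ProperSubd (H D : Dgr) : Prop := Subd H D ∧ ¬ Subd D H

/-- a relation is acyclic: no directed cycle through any vertex -/
def Acy (R : ℕ → ℕ → Prop) : Prop := ∀ v, ¬ Relation.TransGen R v v

/-- a `k`-dicolouring: each colour class induces an acyclic subdigraph -/
def IsDicol (D : Dgr) {k : ℕ} (φ : ℕ → Fin k) : Prop :=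
  Acy (fun u v => D.Adj u v ∧ φ u = φ v)

def Dicolourable (D : Dgr) (k : ℕ) : Prop := ∃ φ : ℕ → Fin k, D.IsDicol φ

/-- the dichromatic number -/
noncomputable def dichr (D : Dgr) : ℕ := sInf {k | D.Dicolourable k}

/-- `k`-dicritical digraphs -/
def Dicritical (k : ℕ) (D : Dgr) : Prop :=
  D.dichr = k ∧ ∀ H : Dgr, ProperSubd H D → H.dichr < k

def Bidirected (D : Dgr) : Prop := ∀ ⦃u v : ℕ⦄, D.Adj u v → D.Adj v u

def Oriented (D : Dgr) : Prop := ∀ ⦃u v : ℕ⦄, D.Adj u v → ¬ D.Adj v u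

/-- being a bidirected complete digraph on `n` vertices -/
def IsBidirComplete (n : ℕ) (D : Dgr) : Prop :=
  D.verts.card = n ∧ ∀ u ∈ D.verts, ∀ v ∈ D.verts, u ≠ v → D.Adj u v

/-- a packing of digons (2-sets) and bidirected triangles (3-sets) -/
def IsPacking (D : Dgr) (P : Finset (Finset ℕ)) : Prop :=
  (∀ s ∈ P, (s.card = 2 ∨ s.card = 3) ∧ s ⊆ D.verts ∧
      ∀ u ∈ s, ∀ v ∈ s, u ≠ v → D.Adj u v) ∧
  (P : Set (Finset ℕ)).Pairwise Disjoint

/-- `T(D)`: the maximum of `d + 2t` over packings of `d` digons and `t` bidirected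
triangles; a digon contributes `card - 1 = 1`, a triangle `card - 1 = 2`. -/
noncomputable def TT (D : Dgr) : ℕ :=
  sSup {t | ∃ P : Finset (Finset ℕ), D.IsPacking P ∧ t = ∑ s ∈ P, (s.card - 1)}

/-- vertex deletion -/
def del (D : Dgr) (x : ℕ) : Dgr where
  verts := D.verts.erase x
  Adj u v := D.Adj u v ∧ u ≠ x ∧ v ≠ x
  adj_mem := by
    intro u v h
    exact ⟨Finset.mem_erase.2 ⟨h.2.1, (D.adj_mem h.1).1⟩,
           Finset.mem_erase.2 ⟨h.2.2, (D.adj_mem h.1).2⟩⟩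
  adj_irrefl := fun v h => D.adj_irrefl v h.1

/-- induced subdigraph on a set `S` of vertices -/
def induce (D : Dgr) (S : Finset ℕ) : Dgr where
  verts := D.verts ∩ S
  Adj u v := D.Adj u v ∧ u ∈ S ∧ v ∈ S
  adj_mem := by
    intro u v h
    exact ⟨Finset.mem_inter.2 ⟨(D.adj_mem h.1).1, h.2.1⟩,
           Finset.mem_inter.2 ⟨(D.adj_mem h.1).2, h.2.2⟩⟩
  adj_irrefl := fun v h => D.adj_irrefl v h.1

/-- adding a digon between two (distinct, existing) vertices -/
def addDigon (D : Dgr) (x y : ℕ) : Dgr where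
  verts := D.verts
  Adj u v := D.Adj u v ∨
    (x ≠ y ∧ x ∈ D.verts ∧ y ∈ D.verts ∧ ((u = x ∧ v = y) ∨ (u = y ∧ v = x)))
  adj_mem := by
    intro u v h
    rcases h with h | ⟨_, hx, hy, h | h⟩
    · exact D.adj_mem h
    · exact ⟨h.1 ▸ hx, h.2 ▸ hy⟩
    · exact ⟨h.1 ▸ hy, h.2 ▸ hx⟩
  adj_irrefl := by
    intro v h
    rcases h with h | ⟨hxy, _, _, h | h⟩
    · exact D.adj_irrefl v h
    · exact hxy (h.1.symm.trans h.2)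
    · exact hxy (h.2.symm.trans h.1)

/-- removing the digon `[x,y]` (both arcs) -/
def delDigon (D : Dgr) (x y : ℕ) : Dgr where
  verts := D.verts
  Adj u v := D.Adj u v ∧ ¬(u = x ∧ v = y) ∧ ¬(u = y ∧ v = x)
  adj_mem := by intro u v h; exact D.adj_mem h.1
  adj_irrefl := fun v h => D.adj_irrefl v h.1

/-- `D` is an Ore-composition of `D1` (digon side, replaced digon `[x,y]`) and
`D2` (split side, split vertex `z`). -/
def IsOreComp (D1 D2 D : Dgr) : Prop :=
  Bidirected D1 ∧ Bidirected D2 ∧ Disjoint D1.verts D2.verts ∧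
  ∃ (x y z : ℕ) (Z1 Z2 : Set ℕ),
    x ∈ D1.verts ∧ y ∈ D1.verts ∧ x ≠ y ∧ D1.Adj x y ∧
    z ∈ D2.verts ∧
    Z1 ∪ Z2 = {w | D2.Adj z w} ∧ Disjoint Z1 Z2 ∧ Z1.Nonempty ∧ Z2.Nonempty ∧
    D.verts = D1.verts ∪ D2.verts.erase z ∧
    (∀ u v, D.Adj u v ↔
      (D1.Adj u v ∧ ¬(u = x ∧ v = y) ∧ ¬(u = y ∧ v = x)) ∨
      (D2.Adj u v ∧ u ≠ z ∧ v ≠ z) ∨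
      (u = x ∧ v ∈ Z1 ∧ D2.Adj z v) ∨ (v = x ∧ u ∈ Z1 ∧ D2.Adj u z) ∨
      (u = y ∧ v ∈ Z2 ∧ D2.Adj z v) ∨ (v = y ∧ u ∈ Z2 ∧ D2.Adj u z))

/-- degree of a vertex: in-degree plus out-degree -/
noncomputable def deg (D : Dgr) (v : ℕ) : ℕ :=
  {u | D.Adj v u}.ncard + {u | D.Adj u v}.ncard

end Dgr

open Dgr

/-- the class of 4-Ore digraphs -/
inductive IsOre4 : Dgr → Prop
  | k4 : ∀ D : Dgr, IsBidirComplete 4 D → IsOre4 D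
  | comp : ∀ D1 D2 D : Dgr, IsOre4 D1 → IsOre4 D2 → IsOreComp D1 D2 D → IsOre4 D

namespace Dgr

/-- an emerald: a bidirected triangle all of whose vertices have degree 6 in `D` -/
def IsEmerald (D : Dgr) (s : Finset ℕ) : Prop :=
  s.card = 3 ∧ s ⊆ D.verts ∧ (∀ u ∈ s, ∀ v ∈ s, u ≠ v → D.Adj u v) ∧
  ∀ v ∈ s, D.deg v = 6

/-- a diamond: a bidirected `K4` minus a digon `[x,y]`, the two other vertices
having degree 6 in `D` -/
def IsDiamond (D : Dgr) (s : Finset ℕ) : Prop :=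
  s.card = 4 ∧ s ⊆ D.verts ∧ ∃ x ∈ s, ∃ y ∈ s, x ≠ y ∧
    (∀ u ∈ s, ∀ v ∈ s, u ≠ v → ¬(u = x ∧ v = y) → ¬(u = y ∧ v = x) → D.Adj u v) ∧
    (∀ v ∈ s, v ≠ x → v ≠ y → D.deg v = 6)

/-- boundary of an induced subdigraph given by its vertex set `S` -/
def bdry (D : Dgr) (S : Finset ℕ) : Set ℕ :=
  {v | v ∈ S ∧ ∃ u ∈ D.verts, u ∉ S ∧ (D.Adj u v ∨ D.Adj v u)}

/-- Ore-collapsible induced subdigraph, given by its vertex set -/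
def OreCollapsible (D : Dgr) (S : Finset ℕ) : Prop :=
  S ⊆ D.verts ∧ S.card < D.verts.card ∧
  ∃ u v : ℕ, u ≠ v ∧ D.bdry S = {u, v} ∧ IsOre4 ((D.induce S).addDigon u v)

/-- the potential of a digraph, with respect to parameters ε and δ -/
noncomputable def pot (D : Dgr) (ε δ : ℝ) : ℝ :=
  (10/3 + ε) * (D.nV : ℝ) - (D.nA : ℝ) - δ * (D.TT : ℝ)

end Dgr

namespace Dgr
open Classical in
/-- arc finset -/
noncomputable def arcs (D : Dgr) : Finset (ℕ × ℕ) :=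
  (D.verts ×ˢ D.verts).filter (fun p => D.Adj p.1 p.2)

lemma mem_arcs {D : Dgr} {q : ℕ × ℕ} : q ∈ D.arcs ↔ D.Adj q.1 q.2 := by
  classical
  unfold arcs
  simp only [Finset.mem_filter, Finset.mem_product]
  exact ⟨fun h => h.2, fun h => ⟨D.adj_mem h, h⟩⟩

lemma nA_eq (D : Dgr) : D.nA = D.arcs.card := by
  unfold nA
  rw [← Set.ncard_coe_finset]
  congr 1
  ext q
  simp [mem_arcs]

/-- colouring of the subdigraph induced by `Q` -/
def Col (D : Dgr) (Q : Finset ℕ) (φ : ℕ → Fin 3) : Prop :=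
  Acy (fun u v => (D.Adj u v ∧ u ∈ Q ∧ v ∈ Q) ∧ φ u = φ v)

lemma acy_mono {R R' : ℕ → ℕ → Prop} (h : ∀ u v, R u v → R' u v) (hR : Acy R') : Acy R :=
  fun v hv => hR v (Relation.TransGen.mono h _ _ hv)

lemma Col.mono {D : Dgr} {Q Q' : Finset ℕ} {φ : ℕ → Fin 3} (h : D.Col Q φ) (hs : Q' ⊆ Q) :
    D.Col Q' φ :=
  acy_mono (fun _ _ h' => ⟨⟨h'.1.1, hs h'.1.2.1, hs h'.1.2.2⟩, h'.2⟩) h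

lemma Col.congr {D : Dgr} {Q : Finset ℕ} {φ ψ : ℕ → Fin 3} (h : D.Col Q φ)
    (he : ∀ v ∈ Q, ψ v = φ v) : D.Col Q ψ := by
  refine acy_mono (fun u v h' => ⟨h'.1, ?_⟩) h
  rw [← he u h'.1.2.1, ← he v h'.1.2.2]; exact h'.2

/-- reversal -/
def rev (D : Dgr) : Dgr where
  verts := D.verts
  Adj u v := D.Adj v u
  adj_mem := fun _ _ h => ⟨(D.adj_mem h).2, (D.adj_mem h).1⟩
  adj_irrefl := D.adj_irrefl

lemma acy_swap {R R' : ℕ → ℕ → Prop} (h : ∀ u v, R u v → R' v u) (hR : Acy R') : Acy R := by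
  intro v hv
  apply hR v
  have : Relation.TransGen (Function.swap R') v v := Relation.TransGen.mono h _ _ hv
  rwa [Relation.transGen_swap] at this

lemma Col.rev {D : Dgr} {Q : Finset ℕ} {φ : ℕ → Fin 3} (h : D.Col Q φ) : D.rev.Col Q φ :=
  acy_swap (fun _ _ h' => ⟨⟨h'.1.1, h'.1.2.2, h'.1.2.1⟩, h'.2.symm⟩) h

lemma col_rev_iff {D : Dgr} {Q : Finset ℕ} {φ : ℕ → Fin 3} : D.rev.Col Q φ ↔ D.Col Q φ :=
  ⟨fun h => h.rev, fun h => h.rev⟩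

lemma Col.extend_in {D : Dgr} {Q : Finset ℕ} {φ : ℕ → Fin 3} (h : D.Col Q φ) {v : ℕ} {c : Fin 3}
    (hv : v ∉ Q) (hc : ∀ u ∈ Q, D.Adj u v → φ u ≠ c) :
    D.Col (insert v Q) (Function.update φ v c) := by
  intro a ha
  have key : ∀ u w, ((D.Adj u w ∧ u ∈ insert v Q ∧ w ∈ insert v Q) ∧
      Function.update φ v c u = Function.update φ v c w) → w ≠ v := by
    rintro u w ⟨⟨h1, h2, h3⟩, h4⟩ rfl
    rcases Finset.mem_insert.1 h2 with rfl | h2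
    · exact D.adj_irrefl _ h1
    · have : u ≠ w := fun e => hv (e ▸ h2)
      rw [Function.update_of_ne this, Function.update_self] at h4
      exact hc u h2 h1 h4
  have hav : a ≠ v := by
    rcases Relation.TransGen.tail'_iff.1 ha with ⟨b, _, hb⟩
    exact key _ _ hb
  have main : ∀ b, Relation.TransGen (fun u w => (D.Adj u w ∧ u ∈ insert v Q ∧ w ∈ insert v Q) ∧
      Function.update φ v c u = Function.update φ v c w) a b →
      Relation.TransGen (fun u w => (D.Adj u w ∧ u ∈ Q ∧ w ∈ Q) ∧ φ u = φ w) a b := by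
    intro b hb
    have st : ∀ u w, u ≠ v → ((D.Adj u w ∧ u ∈ insert v Q ∧ w ∈ insert v Q) ∧
      Function.update φ v c u = Function.update φ v c w) →
      ((D.Adj u w ∧ u ∈ Q ∧ w ∈ Q) ∧ φ u = φ w) := by
      intro u w hu huw
      have hw := key _ _ huw
      obtain ⟨⟨h1, h2, h3⟩, h4⟩ := huw
      rw [Function.update_of_ne hu, Function.update_of_ne hw] at h4
      exact ⟨⟨h1, (Finset.mem_insert.1 h2).resolve_left hu,
        (Finset.mem_insert.1 h3).resolve_left hw⟩, h4⟩
    induction hb with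
    | single hb => exact .single (st _ _ hav hb)
    | tail hb hbc ih =>
      refine ih.tail (st _ _ ?_ hbc)
      rcases Relation.TransGen.tail'_iff.1 hb with ⟨b, _, hb⟩
      exact key _ _ hb
  exact h a (main a ha)

lemma Col.extend_out {D : Dgr} {Q : Finset ℕ} {φ : ℕ → Fin 3} (h : D.Col Q φ) {v : ℕ} {c : Fin 3}
    (hv : v ∉ Q) (hc : ∀ u ∈ Q, D.Adj v u → φ u ≠ c) :
    D.Col (insert v Q) (Function.update φ v c) :=
  col_rev_iff.1 (Col.extend_in (D := D.rev) h.rev hv hc)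

/-- critical -/
def Crit (D : Dgr) : Prop :=
  ¬ D.Dicolourable 3 ∧ ∀ H : Dgr, ProperSubd H D → H.Dicolourable 3

lemma col_iff (D : Dgr) (φ : ℕ → Fin 3) : D.Col D.verts φ ↔ D.IsDicol φ := by
  constructor
  · exact fun h => acy_mono (fun u v h' => ⟨⟨h'.1, D.adj_mem h'.1⟩, h'.2⟩) h
  · exact fun h => acy_mono (fun u v h' => ⟨h'.1.1, h'.2⟩) h

lemma Crit.not_col {D : Dgr} (h : D.Crit) (φ : ℕ → Fin 3) : ¬ D.Col D.verts φ :=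
  fun h' => h.1 ⟨φ, (col_iff D φ).1 h'⟩

lemma induce_proper {D : Dgr} {Q : Finset ℕ} (hQ : Q ⊆ D.verts) (hne : Q ≠ D.verts) :
    ProperSubd (D.induce Q) D := by
  refine ⟨⟨Finset.inter_subset_left, fun _ _ h => h.1⟩, fun h => hne ?_⟩
  exact hQ.antisymm (fun x hx => (Finset.mem_inter.1 (h.1 hx)).2)

lemma Crit.exists_col {D : Dgr} (h : D.Crit) {Q : Finset ℕ} (hQ : Q ⊆ D.verts)
    (hne : Q ≠ D.verts) : ∃ φ, D.Col Q φ :=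
  h.2 _ (induce_proper hQ hne)

lemma Crit.no_sub {D W : Dgr} (h : D.Crit) (hW : W.Crit) (hs : Subd W D)
    (hne : W.verts ≠ D.verts) : False :=
  hW.1 (h.2 W ⟨hs, fun h' => hne (hs.1.antisymm h'.1)⟩)

lemma Crit.rev {D : Dgr} (h : D.Crit) : D.rev.Crit := by
  constructor
  · rintro ⟨φ, hφ⟩
    exact h.not_col φ (col_rev_iff.1 ((col_iff D.rev φ).2 hφ))
  · intro H hH
    obtain ⟨φ, hφ⟩ := h.2 H.rev ⟨⟨hH.1.1, fun u v huv => hH.1.2 huv⟩,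
      fun h' => hH.2 ⟨h'.1, fun u v huv => h'.2 huv⟩⟩
    exact ⟨φ, (col_iff H φ).1 (col_rev_iff.1 ((col_iff H.rev φ).2 hφ))⟩

lemma dicol_mono {D : Dgr} {k l : ℕ} (hkl : k ≤ l) (h : D.Dicolourable k) : D.Dicolourable l := by
  obtain ⟨φ, hφ⟩ := h
  exact ⟨fun v => Fin.castLE hkl (φ v),
    acy_mono (fun u v h' => ⟨h'.1, Fin.castLE_injective hkl h'.2⟩) hφ⟩

lemma dicol_some (D : Dgr) : ∃ k, D.Dicolourable k := by
  refine ⟨D.verts.sup id + 1, fun v => Fin.ofNat _ v, ?_⟩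
  refine acy_mono (R' := fun _ _ => False) ?_ ?_
  · rintro u v ⟨h1, h2⟩
    obtain ⟨hu, hv⟩ := D.adj_mem h1
    have hu' : u ≤ D.verts.sup id := Finset.le_sup (f := id) hu
    have hv' : v ≤ D.verts.sup id := Finset.le_sup (f := id) hv
    have := congrArg Fin.val h2
    simp only [Fin.ofNat] at this
    rw [Nat.mod_eq_of_lt (by omega), Nat.mod_eq_of_lt (by omega)] at this
    exact D.adj_irrefl v (this ▸ h1)
  · intro v hv
    rcases Relation.TransGen.tail'_iff.1 hv with ⟨b, _, hb⟩
    exact hb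

lemma Dicritical.crit {D : Dgr} (h : Dicritical 4 D) : D.Crit := by
  constructor
  · intro h3
    have : D.dichr ≤ 3 := Nat.sInf_le h3
    have := h.1
    omega
  · intro H hH
    have h1 := h.2 H hH
    have h2 : H.Dicolourable H.dichr := Nat.sInf_mem (dicol_some H)
    exact dicol_mono (by omega) h2

open Classical in
noncomputable def dout (D : Dgr) (v : ℕ) : ℕ := (D.verts.filter (fun u => D.Adj v u)).card
noncomputable def din (D : Dgr) (v : ℕ) : ℕ := D.rev.dout v

lemma din_rev (D : Dgr) (v : ℕ) : D.rev.din v = D.dout v := rfl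
lemma dout_rev (D : Dgr) (v : ℕ) : D.rev.dout v = D.din v := rfl

open Classical in
lemma din_eq (D : Dgr) (v : ℕ) : D.din v = (D.verts.filter (fun u => D.Adj u v)).card := rfl

lemma exists_color (s : Finset (Fin 3)) (hs : s.card < 3) : ∃ c, c ∉ s := by
  by_contra h
  push Not at h
  have : s = Finset.univ := Finset.eq_univ_iff_forall.2 h
  rw [this] at hs
  simp at hs

lemma Crit.dout_ge {D : Dgr} (h : D.Crit) {v : ℕ} (hv : v ∈ D.verts) : 3 ≤ D.dout v := by
  classical
  by_contra hlt
  obtain ⟨φ, hφ⟩ := h.exists_col (Q := D.verts.erase v) (Finset.erase_subset _ _)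
    (fun e => Finset.notMem_erase v D.verts (by rw [e]; exact hv))
  obtain ⟨c, hc⟩ := exists_color ((D.verts.filter (fun u => D.Adj v u)).image φ)
    (lt_of_le_of_lt Finset.card_image_le (by unfold dout at hlt; convert not_le.1 hlt))
  have := hφ.extend_out (v := v) (c := c) (Finset.notMem_erase v _) (fun u hu hvu e => hc
    (Finset.mem_image.2 ⟨u, Finset.mem_filter.2 ⟨Finset.mem_of_mem_erase hu, hvu⟩, e⟩))
  rw [Finset.insert_erase hv] at this
  exact h.not_col _ this

lemma Crit.din_ge {D : Dgr} (h : D.Crit) {v : ℕ} (hv : v ∈ D.verts) : 3 ≤ D.din v :=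
  h.rev.dout_ge (D := D.rev) hv

lemma Crit.nonempty {D : Dgr} (h : D.Crit) : D.verts.Nonempty := by
  by_contra hne
  rw [Finset.not_nonempty_iff_eq_empty] at hne
  refine h.not_col (fun _ => 0) ?_
  intro v hv
  rcases Relation.TransGen.tail'_iff.1 hv with ⟨b, _, hb⟩
  rw [hne] at hb
  exact absurd hb.1.2.1 (Finset.notMem_empty _)

lemma dout_le_erase (D : Dgr) (v : ℕ) : D.dout v ≤ (D.verts.erase v).card := by
  classical
  apply Finset.card_le_card
  intro u hu
  rw [Finset.mem_filter] at hu
  exact Finset.mem_erase.2 ⟨fun e => D.adj_irrefl v (e ▸ hu.2), hu.1⟩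

lemma Crit.four_le {D : Dgr} (h : D.Crit) : 4 ≤ D.verts.card := by
  obtain ⟨v, hv⟩ := h.nonempty
  have h1 := h.dout_ge hv
  have h2 := dout_le_erase D v
  rw [Finset.card_erase_of_mem hv] at h2
  omega

lemma Crit.k4 {D : Dgr} (h : D.Crit) (h4 : D.verts.card = 4) : IsBidirComplete 4 D := by
  classical
  refine ⟨h4, fun u hu v hv huv => ?_⟩
  have h1 := h.dout_ge hu
  have hs : (D.verts.filter (fun w => D.Adj u w)) ⊆ D.verts.erase u := by
    intro w hw
    rw [Finset.mem_filter] at hw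
    exact Finset.mem_erase.2 ⟨fun e => D.adj_irrefl u (e ▸ hw.2), hw.1⟩
  have he := Finset.eq_of_subset_of_card_le hs (by
    rw [Finset.card_erase_of_mem hu, h4]; unfold dout at h1; convert h1)
  have : v ∈ D.verts.erase u := Finset.mem_erase.2 ⟨huv.symm, hv⟩
  rw [← he] at this
  exact (Finset.mem_filter.1 this).2

lemma arcs_mono {H D : Dgr} (h : Subd H D) : H.arcs ⊆ D.arcs :=
  fun _ hq => mem_arcs.2 (h.2 (mem_arcs.1 hq))

lemma exists_crit (H : Dgr) (h : ¬ H.Dicolourable 3) : ∃ W : Dgr, Subd W H ∧ W.Crit := by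
  generalize hN : H.verts.card + H.arcs.card = N
  induction N using Nat.strong_induction_on generalizing H with
  | _ N ih =>
    by_cases hc : H.Crit
    · exact ⟨H, ⟨subset_rfl, fun _ _ h => h⟩, hc⟩
    · unfold Crit at hc
      push Not at hc
      obtain ⟨H', hp, hn⟩ := hc h
      have hlt : H'.verts.card + H'.arcs.card < N := by
        rw [← hN]
        have h1 := Finset.card_le_card hp.1.1
        have h2 := Finset.card_le_card (arcs_mono hp.1)
        by_contra hge
        have e1 := Finset.eq_of_subset_of_card_le hp.1.1 (by omega)
        have e2 := Finset.eq_of_subset_of_card_le (arcs_mono hp.1) (by omega)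
        refine hp.2 ⟨e1 ▸ subset_rfl, fun u v huv => ?_⟩
        have : (u, v) ∈ H.arcs := mem_arcs.2 huv
        rw [← e2] at this
        exact mem_arcs.1 this
      obtain ⟨W, hW, hWc⟩ := ih _ hlt H' hn rfl
      exact ⟨W, ⟨hW.1.trans hp.1.1, fun u v huv => hp.1.2 (hW.2 huv)⟩, hWc⟩
end Dgr

namespace Dgr
/-- a digon or bidirected triangle -/
def Clq (D : Dgr) (s : Finset ℕ) : Prop :=
  (s.card = 2 ∨ s.card = 3) ∧ s ⊆ D.verts ∧ ∀ u ∈ s, ∀ v ∈ s, u ≠ v → D.Adj u v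

def Dig (D : Dgr) (u v : ℕ) : Prop := D.Adj u v ∧ D.Adj v u

lemma Dig.symm {D : Dgr} {u v : ℕ} (h : D.Dig u v) : D.Dig v u := ⟨h.2, h.1⟩
lemma Dig.ne {D : Dgr} {u v : ℕ} (h : D.Dig u v) : u ≠ v := fun e => D.adj_irrefl v (e ▸ h.1)

lemma clq_pair {D : Dgr} {u v : ℕ} (h : D.Dig u v) : D.Clq {u, v} := by
  refine ⟨Or.inl (Finset.card_pair h.ne), ?_, ?_⟩
  · intro x hx
    simp only [Finset.mem_insert, Finset.mem_singleton] at hx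
    rcases hx with rfl | rfl
    · exact (D.adj_mem h.1).1
    · exact (D.adj_mem h.1).2
  · intro x hx y hy hxy
    simp only [Finset.mem_insert, Finset.mem_singleton] at hx hy
    rcases hx with rfl | rfl <;> rcases hy with rfl | rfl
    · exact absurd rfl hxy
    · exact h.1
    · exact h.2
    · exact absurd rfl hxy

lemma clq_triple {D : Dgr} {u v w : ℕ} (h : D.Dig u v) (h2 : D.Dig u w) (h3 : D.Dig v w) :
    D.Clq {u, v, w} := by
  refine ⟨Or.inr (Finset.card_eq_three.2 ⟨u, v, w, h.ne, h2.ne, h3.ne, rfl⟩), ?_, ?_⟩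
  · intro x hx
    simp only [Finset.mem_insert, Finset.mem_singleton] at hx
    rcases hx with rfl | rfl | rfl
    · exact (D.adj_mem h.1).1
    · exact (D.adj_mem h.1).2
    · exact (D.adj_mem h3.1).2
  · intro x hx y hy hxy
    simp only [Finset.mem_insert, Finset.mem_singleton] at hx hy
    rcases hx with rfl | rfl | rfl <;> rcases hy with rfl | rfl | rfl <;>
      first | exact absurd rfl hxy | exact h.1 | exact h.2 | exact h2.1 | exact h2.2 | exact h3.1 | exact h3.2

lemma packing_card {D : Dgr} {P : Finset (Finset ℕ)} (h : D.IsPacking P) :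
    ∑ s ∈ P, (s.card - 1) ≤ D.verts.card := by
  classical
  calc ∑ s ∈ P, (s.card - 1) ≤ ∑ s ∈ P, s.card := Finset.sum_le_sum (fun s _ => Nat.sub_le _ _)
    _ = (P.biUnion id).card := by
        rw [Finset.card_biUnion]
        · rfl
        · intro s hs t ht hst
          exact h.2 hs ht hst
    _ ≤ D.verts.card := by
        apply Finset.card_le_card
        intro x hx
        obtain ⟨s, hs, hxs⟩ := Finset.mem_biUnion.1 hx
        exact (h.1 s hs).2.1 hxs

lemma TT_bdd (D : Dgr) :
    BddAbove {t | ∃ P : Finset (Finset ℕ), D.IsPacking P ∧ t = ∑ s ∈ P, (s.card - 1)} := by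
  refine ⟨D.verts.card, ?_⟩
  rintro t ⟨P, hP, rfl⟩
  exact packing_card hP

lemma TT_ge {D : Dgr} {P : Finset (Finset ℕ)} (h : D.IsPacking P) :
    ∑ s ∈ P, (s.card - 1) ≤ D.TT := le_csSup (TT_bdd D) ⟨P, h, rfl⟩

lemma TT_exists (D : Dgr) : ∃ P : Finset (Finset ℕ), D.IsPacking P ∧ D.TT = ∑ s ∈ P, (s.card - 1) :=
  Nat.sSup_mem (s := {t | ∃ P : Finset (Finset ℕ), D.IsPacking P ∧ t = ∑ s ∈ P, (s.card - 1)})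
    ⟨0, ∅, ⟨by simp, by simp⟩, by simp⟩ (TT_bdd D)

lemma Clq.mono {H D : Dgr} (h : Subd H D) {s : Finset ℕ} (hs : H.Clq s) : D.Clq s :=
  ⟨hs.1, hs.2.1.trans h.1, fun u hu v hv huv => h.2 (hs.2.2 u hu v hv huv)⟩

lemma IsPacking.mono {H D : Dgr} (h : Subd H D) {P} (hP : H.IsPacking P) : D.IsPacking P :=
  ⟨fun s hs => Clq.mono h (hP.1 s hs), hP.2⟩

lemma TT_mono {H D : Dgr} (h : Subd H D) : H.TT ≤ D.TT := by
  obtain ⟨P, hP, he⟩ := TT_exists H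
  rw [he]
  exact TT_ge (hP.mono h)

lemma Clq.nonempty {D : Dgr} {s : Finset ℕ} (hs : D.Clq s) : s.Nonempty := by
  rw [← Finset.card_pos]
  rcases hs.1 with h | h <;> omega

lemma packing_insert {D : Dgr} {P : Finset (Finset ℕ)} (hP : D.IsPacking P) {s : Finset ℕ}
    (hs : D.Clq s) (hd : ∀ t ∈ P, Disjoint s t) :
    D.IsPacking (insert s P) ∧
      ∑ t ∈ insert s P, (t.card - 1) = (s.card - 1) + ∑ t ∈ P, (t.card - 1) := by
  have hn : s ∉ P := by
    intro h
    have := hd s h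
    rw [disjoint_self] at this
    exact hs.nonempty.ne_empty this
  refine ⟨⟨?_, ?_⟩, Finset.sum_insert hn⟩
  · intro t ht
    rcases Finset.mem_insert.1 ht with rfl | ht
    · exact hs
    · exact hP.1 t ht
  · intro a ha b hb hab
    rw [Finset.mem_coe, Finset.mem_insert] at ha hb
    rcases ha with rfl | ha <;> rcases hb with rfl | hb
    · exact absurd rfl hab
    · exact hd b hb
    · exact (hd a ha).symm
    · exact hP.2 ha hb hab

lemma packing_union {D D1 D2 : Dgr} (h1 : Subd D1 D) (h2 : Subd D2 D)
    (hd : Disjoint D1.verts D2.verts) {P1 P2 : Finset (Finset ℕ)} (hP1 : D1.IsPacking P1)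
    (hP2 : D2.IsPacking P2) : D.IsPacking (P1 ∪ P2) ∧
      ∑ t ∈ P1 ∪ P2, (t.card - 1) = ∑ t ∈ P1, (t.card - 1) + ∑ t ∈ P2, (t.card - 1) := by
  have hdd : ∀ s ∈ P1, ∀ t ∈ P2, Disjoint s t := fun s hs t ht =>
    Finset.disjoint_of_subset_left (hP1.1 s hs).2.1
      (Finset.disjoint_of_subset_right (hP2.1 t ht).2.1 hd)
  refine ⟨⟨?_, ?_⟩, Finset.sum_union ?_⟩
  · intro t ht
    rcases Finset.mem_union.1 ht with ht | ht
    · exact (hP1.mono h1).1 t ht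
    · exact (hP2.mono h2).1 t ht
  · intro a ha b hb hab
    rw [Finset.mem_coe, Finset.mem_union] at ha hb
    rcases ha with ha | ha <;> rcases hb with hb | hb
    · exact hP1.2 ha hb hab
    · exact hdd a ha b hb
    · exact (hdd b hb a ha).symm
    · exact hP2.2 ha hb hab
  · rw [Finset.disjoint_left]
    intro s hs hs'
    have := hdd s hs s hs'
    rw [disjoint_self] at this
    exact (Clq.nonempty (hP1.1 s hs)).ne_empty this

lemma TT_add {D D1 D2 : Dgr} (h1 : Subd D1 D) (h2 : Subd D2 D)
    (hd : Disjoint D1.verts D2.verts) : D1.TT + D2.TT ≤ D.TT := by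
  obtain ⟨P1, hP1, e1⟩ := TT_exists D1
  obtain ⟨P2, hP2, e2⟩ := TT_exists D2
  obtain ⟨h, e⟩ := packing_union h1 h2 hd hP1 hP2
  rw [e1, e2, ← e]
  exact TT_ge h

lemma TT_add_clq {D D1 : Dgr} (h1 : Subd D1 D) {s : Finset ℕ} (hs : D.Clq s)
    (hd : Disjoint s D1.verts) : D1.TT + (s.card - 1) ≤ D.TT := by
  obtain ⟨P1, hP1, e1⟩ := TT_exists D1
  obtain ⟨h, e⟩ := packing_insert (hP1.mono h1) hs
    (fun t ht => Finset.disjoint_of_subset_right (hP1.1 t ht).2.1 hd)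
  rw [e1, add_comm, ← e]
  exact TT_ge h

lemma TT_clq {D : Dgr} {s : Finset ℕ} (hs : D.Clq s) : s.card - 1 ≤ D.TT := by
  obtain ⟨h, e⟩ := packing_insert (D := D) (P := ∅) ⟨by simp, by simp⟩ hs (by simp)
  have := TT_ge h
  rw [e] at this
  simpa using this

/-- packing restricted when avoiding a set -/
lemma packing_induce {D : Dgr} {P : Finset (Finset ℕ)} (hP : D.IsPacking P) {A : Finset ℕ}
    (hA : ∀ s ∈ P, s ⊆ A) : (D.induce A).IsPacking P :=
  ⟨fun s hs => ⟨(hP.1 s hs).1, Finset.subset_inter (hP.1 s hs).2.1 (hA s hs),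
    fun u hu v hv huv => ⟨(hP.1 s hs).2.2 u hu v hv huv, hA s hs hu, hA s hs hv⟩⟩, hP.2⟩

lemma TT_erase (D : Dgr) (v : ℕ) : D.TT ≤ (D.induce (D.verts.erase v)).TT + 1 := by
  obtain ⟨P, hP, e⟩ := TT_exists D
  by_cases hv : ∃ s ∈ P, v ∈ s
  · obtain ⟨s, hs, hvs⟩ := hv
    have hother : ∀ t ∈ P.erase s, v ∉ t ∧ Disjoint s t := by
      intro t ht
      have hd := hP.2 hs (Finset.mem_of_mem_erase ht) (Finset.ne_of_mem_erase ht).symm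
      exact ⟨Finset.disjoint_left.1 hd hvs, hd⟩
    have hPe : (D.induce (D.verts.erase v)).IsPacking (P.erase s) :=
      packing_induce ⟨fun t ht => hP.1 t (Finset.mem_of_mem_erase ht),
        fun a ha b hb hab => hP.2 (Finset.mem_of_mem_erase ha) (Finset.mem_of_mem_erase hb) hab⟩
        (fun t ht x hx => Finset.mem_erase.2 ⟨fun e => (hother t ht).1 (e ▸ hx),
          (hP.1 t (Finset.mem_of_mem_erase ht)).2.1 hx⟩)
    have hsum := Finset.add_sum_erase P (fun s => s.card - 1) hs
    rcases (hP.1 s hs).1 with h2 | h3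
    · have := TT_ge hPe
      omega
    · have hc : (s.erase v).card = 2 := by rw [Finset.card_erase_of_mem hvs, h3]
      have hclq : (D.induce (D.verts.erase v)).Clq (s.erase v) := by
        refine ⟨Or.inl hc, ?_, ?_⟩
        · intro x hx
          have hx' := Finset.mem_erase.1 hx
          have := (hP.1 s hs).2.1 hx'.2
          exact Finset.mem_inter.2 ⟨this, Finset.mem_erase.2 ⟨hx'.1, this⟩⟩
        · intro x hx y hy hxy
          have hx' := Finset.mem_erase.1 hx
          have hy' := Finset.mem_erase.1 hy
          exact ⟨(hP.1 s hs).2.2 x hx'.2 y hy'.2 hxy, Finset.mem_erase.2 ⟨hx'.1, (hP.1 s hs).2.1 hx'.2⟩,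
            Finset.mem_erase.2 ⟨hy'.1, (hP.1 s hs).2.1 hy'.2⟩⟩
      obtain ⟨hp, e2⟩ := packing_insert hPe hclq (fun t ht =>
        Finset.disjoint_of_subset_left (Finset.erase_subset _ _) (hother t ht).2)
      have := TT_ge hp
      omega
  · push Not at hv
    have := TT_ge (packing_induce (A := D.verts.erase v) hP
      (fun s hs x hx => Finset.mem_erase.2 ⟨fun e => hv s hs (e ▸ hx), (hP.1 s hs).2.1 hx⟩))
    omega

lemma TT_sdiff (D : Dgr) (X : Finset ℕ) : D.TT ≤ (D.induce (D.verts \ X)).TT + X.card := by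
  induction X using Finset.induction_on with
  | empty =>
    simp only [Finset.sdiff_empty, Finset.card_empty, add_zero]
    exact TT_mono ⟨by simp [induce], fun u v h => ⟨h, D.adj_mem h⟩⟩
  | insert v X hv ih =>
    rw [Finset.card_insert_of_notMem hv]
    have h1 := TT_erase (D.induce (D.verts \ X)) v
    have h2 : ((D.induce (D.verts \ X)).induce ((D.induce (D.verts \ X)).verts.erase v)).TT ≤
        (D.induce (D.verts \ insert v X)).TT := by
      apply TT_mono
      refine ⟨?_, ?_⟩
      · intro x hx
        simp only [induce, Finset.mem_inter, Finset.mem_sdiff, Finset.mem_erase, Finset.mem_insert] at hx ⊢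
        tauto
      · rintro x y ⟨⟨h, h3, h4⟩, h5, h6⟩
        simp only [induce, Finset.mem_inter, Finset.mem_sdiff, Finset.mem_erase, Finset.mem_insert] at *
        tauto
    omega

/-- removing a digon loses at most one: if `H` contains all arcs of `D` except those of the digon `uv` -/
lemma TT_digon {D H : Dgr} (u v : ℕ) (hV : D.verts ⊆ H.verts)
    (hA : ∀ x y, D.Adj x y → ¬ (x = u ∧ y = v) → ¬ (x = v ∧ y = u) → H.Adj x y) :
    D.TT ≤ H.TT + 1 := by
  have h1 := TT_erase D u
  have : (D.induce (D.verts.erase u)).TT ≤ H.TT := by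
    apply TT_mono
    refine ⟨Finset.inter_subset_left.trans hV, ?_⟩
    rintro x y ⟨h, hx, hy⟩
    refine hA x y h ?_ ?_
    · rintro ⟨rfl, rfl⟩
      exact Finset.notMem_erase _ _ hx
    · rintro ⟨rfl, rfl⟩
      exact Finset.notMem_erase _ _ hy
  omega

/-- integer potential -/
noncomputable def pw (D : Dgr) : ℤ := 57 * (D.verts.card : ℤ) - 17 * (D.arcs.card : ℤ) - 2 * (D.TT : ℤ)

lemma rev_subd (D : Dgr) : D.rev.TT = D.TT := by
  have : ∀ D : Dgr, D.TT ≤ D.rev.TT := by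
    intro D
    obtain ⟨P, hP, e⟩ := TT_exists D
    rw [e]
    exact TT_ge ⟨fun s hs => ⟨(hP.1 s hs).1, (hP.1 s hs).2.1,
      fun u hu v hv huv => (hP.1 s hs).2.2 v hv u hu huv.symm⟩, hP.2⟩
  exact le_antisymm (this D.rev) (this D)

lemma arcs_rev (D : Dgr) : D.rev.arcs.card = D.arcs.card := by
  apply Finset.card_bij (fun q _ => q.swap)
  · intro q hq
    exact (mem_arcs (D := D)).2 (show D.Adj q.2 q.1 from (mem_arcs (D := D.rev)).1 hq)
  · intro a _ b _ h
    exact Prod.swap_injective h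
  · intro b hb
    exact ⟨b.swap, (mem_arcs (D := D.rev)).2 (show D.Adj b.1 b.2 from (mem_arcs (D := D)).1 hb), by simp⟩

lemma pw_rev (D : Dgr) : D.rev.pw = D.pw := by
  unfold pw
  rw [rev_subd, arcs_rev]
  rfl

/-- potential of induced subdigraph -/
noncomputable def P (D : Dgr) (S : Finset ℕ) : ℤ := (D.induce S).pw

lemma induce_verts {D : Dgr} {S : Finset ℕ} (h : S ⊆ D.verts) : (D.induce S).verts = S :=
  Finset.inter_eq_right.2 h

lemma induce_subd {D : Dgr} {S Q : Finset ℕ} (h : S ⊆ Q) : Subd (D.induce S) (D.induce Q) :=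
  ⟨Finset.inter_subset_inter_left h, fun _ _ h' => ⟨h'.1, h h'.2.1, h h'.2.2⟩⟩

lemma induce_subd' (D : Dgr) (S : Finset ℕ) : Subd (D.induce S) D :=
  ⟨Finset.inter_subset_left, fun _ _ h' => h'.1⟩

lemma mem_arcs_induce {D : Dgr} {S : Finset ℕ} {q : ℕ × ℕ} :
    q ∈ (D.induce S).arcs ↔ D.Adj q.1 q.2 ∧ q.1 ∈ S ∧ q.2 ∈ S := mem_arcs

lemma P_verts (D : Dgr) : D.P D.verts = D.pw := by
  have e1 : (D.induce D.verts).verts = D.verts := induce_verts subset_rfl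
  have e2 : (D.induce D.verts).arcs = D.arcs := by
    ext q
    rw [mem_arcs_induce, mem_arcs]
    exact ⟨fun h => h.1, fun h => ⟨h, D.adj_mem h⟩⟩
  have e3 : (D.induce D.verts).TT = D.TT :=
    le_antisymm (TT_mono (induce_subd' D _)) (TT_mono ⟨e1.symm ▸ subset_rfl, fun u v h => ⟨h, D.adj_mem h⟩⟩)
  unfold P pw
  rw [e1, e2, e3]

/-- adding a vertex -/
lemma arcs_insert {D : Dgr} {S : Finset ℕ} {y : ℕ} (hy : y ∉ S) (A B : Finset ℕ)
    (hA : A ⊆ S) (hB : B ⊆ S) (hA' : ∀ a ∈ A, D.Adj y a) (hB' : ∀ b ∈ B, D.Adj b y) :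
    (D.induce S).arcs.card + A.card + B.card ≤ (D.induce (insert y S)).arcs.card := by
  have i1 : (A.image (fun a => (y, a))).card = A.card :=
    Finset.card_image_of_injective _ (fun a b h => (Prod.mk.inj h).2)
  have i2 : (B.image (fun a => (a, y))).card = B.card :=
    Finset.card_image_of_injective _ (fun a b h => (Prod.mk.inj h).1)
  rw [← i1, ← i2]
  rw [← Finset.card_union_of_disjoint, ← Finset.card_union_of_disjoint]
  · apply Finset.card_le_card
    intro q hq
    rw [mem_arcs_induce]
    rcases Finset.mem_union.1 hq with hq | hq
    · rcases Finset.mem_union.1 hq with hq | hq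
      · rw [mem_arcs_induce] at hq
        exact ⟨hq.1, Finset.mem_insert_of_mem hq.2.1, Finset.mem_insert_of_mem hq.2.2⟩
      · obtain ⟨a, ha, rfl⟩ := Finset.mem_image.1 hq
        exact ⟨hA' a ha, Finset.mem_insert_self _ _, Finset.mem_insert_of_mem (hA ha)⟩
    · obtain ⟨a, ha, rfl⟩ := Finset.mem_image.1 hq
      exact ⟨hB' a ha, Finset.mem_insert_of_mem (hB ha), Finset.mem_insert_self _ _⟩
  · rw [Finset.disjoint_left]
    rintro q hq hq'
    obtain ⟨a, ha, rfl⟩ := Finset.mem_image.1 hq'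
    rcases Finset.mem_union.1 hq with hq | hq
    · rw [mem_arcs_induce] at hq
      exact hy hq.2.2
    · obtain ⟨b, hb, e⟩ := Finset.mem_image.1 hq
      exact hy ((Prod.mk.inj e).1 ▸ hB ha)
  · rw [Finset.disjoint_left]
    rintro q hq hq'
    obtain ⟨a, ha, rfl⟩ := Finset.mem_image.1 hq'
    rw [mem_arcs_induce] at hq
    exact hy hq.2.1
end Dgr

namespace Dgr

/-- a choice of representatives of colour classes -/
def Rep (S : Finset ℕ) (φ : ℕ → Fin 3) (r : ℕ → ℕ) : Prop :=
  (∀ v ∈ S, r v ∈ S ∧ φ (r v) = φ v) ∧ ∀ u ∈ S, ∀ v ∈ S, φ u = φ v → r u = r v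

open Classical in
/-- contraction map -/
noncomputable def cpi (S : Finset ℕ) (r : ℕ → ℕ) (v : ℕ) : ℕ := if v ∈ S then r v else v

lemma cpi_in {S : Finset ℕ} {r : ℕ → ℕ} {v : ℕ} (h : v ∈ S) : cpi S r v = r v := if_pos h
lemma cpi_out {S : Finset ℕ} {r : ℕ → ℕ} {v : ℕ} (h : v ∉ S) : cpi S r v = v := if_neg h

lemma cpi_mem {S : Finset ℕ} {φ : ℕ → Fin 3} {r : ℕ → ℕ} (hr : Rep S φ r) {v : ℕ} :
    cpi S r v ∈ S ↔ v ∈ S := by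
  by_cases h : v ∈ S
  · rw [cpi_in h]; exact ⟨fun _ => h, fun _ => (hr.1 v h).1⟩
  · rw [cpi_out h]

/-- outcome of the contraction -/
structure Ctr (D : Dgr) (Q S : Finset ℕ) (r : ℕ → ℕ) (W : Dgr) : Prop where
  crit : W.Crit
  sub : W.verts ⊆ Q
  fix : ∀ v ∈ W.verts, v ∈ S → r v = v
  lift : ∀ a b, W.Adj a b → (a ∈ S ∧ b ∈ S) ∨
    ∃ u v, D.Adj u v ∧ u ∈ Q ∧ v ∈ Q ∧ cpi S r u = a ∧ cpi S r v = b

/-- the contracted digraph -/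
noncomputable def cH (D : Dgr) (Q S : Finset ℕ) (r : ℕ → ℕ) : Dgr where
  verts := Q.image (cpi S r)
  Adj a b := a ≠ b ∧ a ∈ Q.image (cpi S r) ∧ b ∈ Q.image (cpi S r) ∧
    ((a ∈ S ∧ b ∈ S) ∨ ∃ u v, D.Adj u v ∧ u ∈ Q ∧ v ∈ Q ∧ cpi S r u = a ∧ cpi S r v = b)
  adj_mem := fun _ _ h => ⟨h.2.1, h.2.2.1⟩
  adj_irrefl := fun _ h => h.1 rfl

lemma cH_ncol {D : Dgr} {Q S : Finset ℕ} {φ : ℕ → Fin 3} {r : ℕ → ℕ} (hSQ : S ⊆ Q)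
    (hφ : D.Col S φ) (hr : Rep S φ r)
    (hne : ∀ ψ, D.Col Q ψ → (∀ v ∈ S, ψ v = φ v) → False) : ¬ (cH D Q S r).Dicolourable 3 := by
  classical
  rintro ⟨ψ, hψ⟩
  have mem : ∀ v ∈ S, r v ∈ Q.image (cpi S r) := fun v hv =>
    Finset.mem_image.2 ⟨v, hSQ hv, cpi_in hv⟩
  have dist : ∀ u ∈ S, ∀ v ∈ S, ψ (r u) = ψ (r v) → φ u = φ v := by
    intro u hu v hv he
    by_contra hn
    have hrr : r u ≠ r v := fun e => hn (by rw [← (hr.1 u hu).2, ← (hr.1 v hv).2, e])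
    have h1 : (cH D Q S r).Adj (r u) (r v) :=
      ⟨hrr, mem u hu, mem v hv, Or.inl ⟨(hr.1 u hu).1, (hr.1 v hv).1⟩⟩
    have h2 : (cH D Q S r).Adj (r v) (r u) :=
      ⟨hrr.symm, mem v hv, mem u hu, Or.inl ⟨(hr.1 v hv).1, (hr.1 u hu).1⟩⟩
    exact hψ (r u) ((Relation.TransGen.single ⟨h1, he⟩).tail ⟨h2, he.symm⟩)
  let f : Fin 3 → Fin 3 := fun c => if h : ∃ v ∈ S, φ v = c then ψ (r h.choose) else c
  have hf : ∀ v ∈ S, f (φ v) = ψ (r v) := by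
    intro v hv
    have h : ∃ w ∈ S, φ w = φ v := ⟨v, hv, rfl⟩
    simp only [f, dif_pos h]
    rw [hr.2 _ h.choose_spec.1 v hv h.choose_spec.2]
  obtain ⟨g, hg⟩ := Finset.exists_equiv_extend_of_card_eq (α := Fin 3) (t := (Finset.univ : Finset (Fin 3)))
    (by simp) (s := S.image φ) (f := f) (Finset.subset_univ _) (by
      intro a ha b hb hab
      rw [Finset.mem_coe, Finset.mem_image] at ha hb
      obtain ⟨u, hu, rfl⟩ := ha
      obtain ⟨v, hv, rfl⟩ := hb
      rw [hf u hu, hf v hv] at hab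
      exact dist u hu v hv hab)
  have hσ : ∀ v ∈ S, g.symm ⟨ψ (r v), Finset.mem_univ _⟩ = φ v := by
    intro v hv
    rw [Equiv.symm_apply_eq]
    apply Subtype.ext
    rw [hg _ (Finset.mem_image_of_mem _ hv), hf v hv]
  refine hne (fun v => g.symm ⟨ψ (cpi S r v), Finset.mem_univ _⟩) ?_ (fun v hv => by
    simp only [cpi_in hv]; exact hσ v hv)
  intro a ha
  have step : ∀ u v, ((D.Adj u v ∧ u ∈ Q ∧ v ∈ Q) ∧
      g.symm ⟨ψ (cpi S r u), Finset.mem_univ _⟩ = g.symm ⟨ψ (cpi S r v), Finset.mem_univ _⟩) →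
      (((D.Adj u v ∧ u ∈ S ∧ v ∈ S) ∧ φ u = φ v) ∧ cpi S r u = cpi S r v) ∨
      ((cH D Q S r).Adj (cpi S r u) (cpi S r v) ∧ ψ (cpi S r u) = ψ (cpi S r v)) := by
    rintro u v ⟨⟨h1, h2, h3⟩, h4⟩
    have h5 : ψ (cpi S r u) = ψ (cpi S r v) := by
      have := g.symm.injective h4
      exact congrArg Subtype.val this
    by_cases hpi : cpi S r u = cpi S r v
    · left
      refine ⟨?_, hpi⟩
      have hiff : u ∈ S ↔ v ∈ S := by rw [← cpi_mem hr, hpi, cpi_mem hr]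
      by_cases hu : u ∈ S
      · have hv := hiff.1 hu
        refine ⟨⟨h1, hu, hv⟩, ?_⟩
        rw [cpi_in hu, cpi_in hv] at hpi
        rw [← (hr.1 u hu).2, ← (hr.1 v hv).2, hpi]
      · have hv : v ∉ S := fun h => hu (hiff.2 h)
        rw [cpi_out hu, cpi_out hv] at hpi
        exact absurd (hpi ▸ h1) (D.adj_irrefl _)
    · right
      exact ⟨⟨hpi, Finset.mem_image_of_mem _ h2, Finset.mem_image_of_mem _ h3,
        Or.inr ⟨u, v, h1, h2, h3, rfl, rfl⟩⟩, h5⟩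
  have main : ∀ b, Relation.TransGen (fun u v => (D.Adj u v ∧ u ∈ Q ∧ v ∈ Q) ∧
      g.symm ⟨ψ (cpi S r u), Finset.mem_univ _⟩ = g.symm ⟨ψ (cpi S r v), Finset.mem_univ _⟩) a b →
      (Relation.TransGen (fun u v => (D.Adj u v ∧ u ∈ S ∧ v ∈ S) ∧ φ u = φ v) a b ∧
        cpi S r a = cpi S r b) ∨
      Relation.TransGen (fun u v => (cH D Q S r).Adj u v ∧ ψ u = ψ v) (cpi S r a) (cpi S r b) := by
    intro b hb
    induction hb with
    | single h =>
      rcases step _ _ h with h | h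
      · exact Or.inl ⟨.single h.1, h.2⟩
      · exact Or.inr (.single h)
    | tail _ h ih =>
      rcases step _ _ h with h | h <;> rcases ih with ih | ih
      · exact Or.inl ⟨ih.1.tail h.1, ih.2.trans h.2⟩
      · right; rw [← h.2]; exact ih
      · right; rw [ih.2]; exact .single h
      · exact Or.inr (ih.tail h)
  rcases main a ha with h | h
  · exact hφ a h.1
  · exact hψ _ h

lemma contract {D : Dgr} {Q S : Finset ℕ} {φ : ℕ → Fin 3} {r : ℕ → ℕ} (hSQ : S ⊆ Q)
    (hφ : D.Col S φ) (hr : Rep S φ r)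
    (hne : ∀ ψ, D.Col Q ψ → (∀ v ∈ S, ψ v = φ v) → False) : ∃ W, Ctr D Q S r W := by
  obtain ⟨W, hs, hW⟩ := exists_crit _ (cH_ncol hSQ hφ hr hne)
  refine ⟨W, hW, ?_, ?_, fun a b h => (hs.2 h).2.2.2⟩
  · intro v hv
    obtain ⟨u, hu, rfl⟩ := Finset.mem_image.1 (hs.1 hv)
    by_cases h : u ∈ S
    · rw [cpi_in h]; exact hSQ (hr.1 u h).1
    · rw [cpi_out h]; exact hu
  · intro v hv hvS
    obtain ⟨u, hu, rfl⟩ := Finset.mem_image.1 (hs.1 hv)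
    have h := (cpi_mem hr).1 hvS
    rw [cpi_in h] at hvS ⊢
    exact hr.2 _ hvS u h (hr.1 u h).2

lemma exists_rep (S : Finset ℕ) (φ : ℕ → Fin 3) : ∃ r, Rep S φ r := by
  classical
  refine ⟨fun v => if h : ∃ w ∈ S, φ w = φ v then h.choose else v, ?_, ?_⟩
  · intro v hv
    have h : ∃ w ∈ S, φ w = φ v := ⟨v, hv, rfl⟩
    simp only [dif_pos h]
    exact h.choose_spec
  · intro u hu v hv e
    have h : ∃ w ∈ S, φ w = φ v := ⟨v, hv, rfl⟩
    simp only [e, dif_pos h]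

/-- representatives including a given vertex -/
lemma exists_rep_at (S : Finset ℕ) (φ : ℕ → Fin 3) {s : ℕ} (hs : s ∈ S) :
    ∃ r, Rep S φ r ∧ r s = s := by
  classical
  obtain ⟨r, hr⟩ := exists_rep S φ
  refine ⟨fun v => if φ v = φ s then s else r v, ⟨?_, ?_⟩, by simp⟩
  · intro v hv
    by_cases h : φ v = φ s
    · simp [h, hs]
    · simp only [h, if_false]; exact hr.1 v hv
  · intro u hu v hv e
    by_cases h : φ v = φ s
    · simp [h, e]
    · simp only [h, e, if_false]; exact hr.2 u hu v hv e

section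
variable {D : Dgr} {Q S : Finset ℕ} {φ : ℕ → Fin 3} {r : ℕ → ℕ} {W : Dgr}

lemma Ctr.inj (hc : Ctr D Q S r W) (hr : Rep S φ r) : ∀ a ∈ W.verts ∩ S, ∀ b ∈ W.verts ∩ S,
    φ a = φ b → a = b := by
  intro a ha b hb e
  rw [Finset.mem_inter] at ha hb
  rw [← hc.fix a ha.1 ha.2, ← hc.fix b hb.1 hb.2]
  exact hr.2 a ha.2 b hb.2 e

lemma Ctr.le3 (hc : Ctr D Q S r W) (hr : Rep S φ r) : (W.verts ∩ S).card ≤ 3 := by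
  have := Finset.card_le_card_of_injOn (s := W.verts ∩ S) (t := (Finset.univ : Finset (Fin 3))) φ
    (fun _ _ => Finset.mem_univ _) (fun a ha b hb e => hc.inj hr a ha b hb e)
  simpa using this

lemma Ctr.uu (hc : Ctr D Q S r W) (hr : Rep S φ r) {a b : ℕ} (h : W.Adj a b) (ha : a ∉ S)
    (hb : b ∉ S) : D.Adj a b := by
  rcases hc.lift a b h with h | ⟨u, v, h1, _, _, rfl, rfl⟩
  · exact absurd h.1 ha
  · rw [cpi_mem hr] at ha hb
    rwa [cpi_out ha, cpi_out hb]

lemma Ctr.us (hc : Ctr D Q S r W) (hr : Rep S φ r) {a b : ℕ} (h : W.Adj a b) (ha : a ∉ S)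
    (hb : b ∈ S) : ∃ v ∈ S, r v = b ∧ D.Adj a v := by
  rcases hc.lift a b h with h | ⟨u, v, h1, _, _, rfl, rfl⟩
  · exact absurd h.1 ha
  · rw [cpi_mem hr] at ha hb
    refine ⟨v, hb, (cpi_in hb).symm, ?_⟩
    rwa [cpi_out ha]

lemma Ctr.su (hc : Ctr D Q S r W) (hr : Rep S φ r) {a b : ℕ} (h : W.Adj a b) (ha : a ∈ S)
    (hb : b ∉ S) : ∃ v ∈ S, r v = a ∧ D.Adj v b := by
  rcases hc.lift a b h with h | ⟨u, v, h1, _, _, rfl, rfl⟩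
  · exact absurd h.2 hb
  · rw [cpi_mem hr] at ha hb
    refine ⟨u, ha, (cpi_in ha).symm, ?_⟩
    rwa [cpi_out hb]

lemma Ctr.pos (hc : Ctr D Q S r W) (hr : Rep S φ r) (hD : D.Crit) (hQ : Q ⊆ D.verts) (hSQ : S ⊆ Q)
    (hS : S.Nonempty) : 1 ≤ (W.verts ∩ S).card := by
  rw [Nat.one_le_iff_ne_zero]
  intro h0
  rw [Finset.card_eq_zero] at h0
  have hn : ∀ v ∈ W.verts, v ∉ S := fun v hv hvS => by
    have : v ∈ W.verts ∩ S := Finset.mem_inter.2 ⟨hv, hvS⟩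
    rw [h0] at this
    exact Finset.notMem_empty _ this
  obtain ⟨s, hs⟩ := hS
  exact hD.no_sub hc.crit ⟨hc.sub.trans hQ, fun u v h =>
    hc.uu hr h (hn u (W.adj_mem h).1) (hn v (W.adj_mem h).2)⟩
    (fun e => hn s (e ▸ hQ (hSQ hs)) hs)

lemma Ctr.arcs (hc : Ctr D Q S r W) (hr : Rep S φ r) (E : Finset (ℕ × ℕ))
    (hE : ∀ e ∈ E, D.Adj e.1 e.2 ∧ e.1 ∈ S ∪ W.verts ∧ e.2 ∈ S ∪ W.verts ∧ ¬ (e.1 ∈ S ∧ e.2 ∈ S) ∧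
      ((e.1 ∈ S ∧ r e.1 ∉ W.verts) ∨ (e.2 ∈ S ∧ r e.2 ∉ W.verts))) :
    (D.induce S).arcs.card + W.arcs.card + E.card ≤
      (D.induce (S ∪ W.verts)).arcs.card + (W.verts ∩ S).card * ((W.verts ∩ S).card - 1) := by
  classical
  have hL : ∀ q : ℕ × ℕ, ∃ q' : ℕ × ℕ, q ∈ W.arcs → ¬ (q.1 ∈ S ∧ q.2 ∈ S) →
      D.Adj q'.1 q'.2 ∧ q'.1 ∈ S ∪ W.verts ∧ q'.2 ∈ S ∪ W.verts ∧ ¬ (q'.1 ∈ S ∧ q'.2 ∈ S) ∧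
      cpi S r q'.1 = q.1 ∧ cpi S r q'.2 = q.2 := by
    intro q
    by_cases hq : q ∈ W.arcs ∧ ¬ (q.1 ∈ S ∧ q.2 ∈ S)
    · have hadj := mem_arcs.1 hq.1
      rcases hc.lift _ _ hadj with h | ⟨u, v, h1, h2, h3, h4, h5⟩
      · exact absurd h hq.2
      · refine ⟨(u, v), fun _ _ => ⟨h1, ?_, ?_, ?_, h4, h5⟩⟩
        · by_cases hu : u ∈ S
          · exact Finset.mem_union_left _ hu
          · rw [cpi_out hu] at h4
            exact Finset.mem_union_right _ (h4 ▸ (W.adj_mem hadj).1)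
        · by_cases hu : v ∈ S
          · exact Finset.mem_union_left _ hu
          · rw [cpi_out hu] at h5
            exact Finset.mem_union_right _ (h5 ▸ (W.adj_mem hadj).2)
        · rw [← cpi_mem hr, ← cpi_mem hr (v := v), h4, h5]; exact hq.2
    · exact ⟨q, fun h1 h2 => absurd ⟨h1, h2⟩ hq⟩
  choose L hL using hL
  let A := W.arcs.filter (fun q => ¬ (q.1 ∈ S ∧ q.2 ∈ S))
  let B := W.arcs.filter (fun q => (q.1 ∈ S ∧ q.2 ∈ S))
  have hAB : W.arcs.card = B.card + A.card :=
    (Finset.card_filter_add_card_filter_not (s := W.arcs) (fun q : ℕ × ℕ => (q.1 ∈ S ∧ q.2 ∈ S))).symm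
  have hB : B.card ≤ (W.verts ∩ S).card * ((W.verts ∩ S).card - 1) := by
    have : B ⊆ (W.verts ∩ S).offDiag := by
      intro q hq
      obtain ⟨hq1, hq2⟩ := Finset.mem_filter.1 hq
      have hadj := mem_arcs.1 hq1
      rw [Finset.mem_offDiag, Finset.mem_inter, Finset.mem_inter]
      exact ⟨⟨(W.adj_mem hadj).1, hq2.1⟩, ⟨(W.adj_mem hadj).2, hq2.2⟩,
        fun e => W.adj_irrefl _ (e ▸ hadj)⟩
    have h := Finset.card_le_card this
    rw [Finset.offDiag_card] at h
    rw [Nat.mul_sub, mul_one]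
    exact h
  have hA : A.card = (A.image L).card := by
    symm
    apply Finset.card_image_of_injOn
    intro a ha b hb e
    obtain ⟨ha1, ha2⟩ := Finset.mem_filter.1 ha
    obtain ⟨hb1, hb2⟩ := Finset.mem_filter.1 hb
    have h1 := (hL a ha1 ha2).2.2.2.2
    have h2 := (hL b hb1 hb2).2.2.2.2
    exact Prod.ext (by rw [← h1.1, ← h2.1, e]) (by rw [← h1.2, ← h2.2, e])
  have hLA : ∀ q ∈ A.image L, D.Adj q.1 q.2 ∧ q.1 ∈ S ∪ W.verts ∧ q.2 ∈ S ∪ W.verts ∧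
      ¬ (q.1 ∈ S ∧ q.2 ∈ S) ∧ cpi S r q.1 ∈ W.verts ∧ cpi S r q.2 ∈ W.verts := by
    intro q hq
    obtain ⟨a, ha, rfl⟩ := Finset.mem_image.1 hq
    obtain ⟨ha1, ha2⟩ := Finset.mem_filter.1 ha
    obtain ⟨h1, h2, h3, h4, h5, h6⟩ := hL a ha1 ha2
    have := W.adj_mem (mem_arcs.1 ha1)
    exact ⟨h1, h2, h3, h4, h5 ▸ this.1, h6 ▸ this.2⟩
  have hall : (D.induce S).arcs.card + (A.image L).card + E.card ≤ (D.induce (S ∪ W.verts)).arcs.card := by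
    rw [← Finset.card_union_of_disjoint, ← Finset.card_union_of_disjoint]
    · apply Finset.card_le_card
      intro q hq
      rw [mem_arcs_induce]
      rcases Finset.mem_union.1 hq with hq | hq
      · rcases Finset.mem_union.1 hq with hq | hq
        · rw [mem_arcs_induce] at hq
          exact ⟨hq.1, Finset.mem_union_left _ hq.2.1, Finset.mem_union_left _ hq.2.2⟩
        · have := hLA q hq
          exact ⟨this.1, this.2.1, this.2.2.1⟩
      · have := hE q hq
        exact ⟨this.1, this.2.1, this.2.2.1⟩
    · rw [Finset.disjoint_left]
      intro q hq hqE
      obtain ⟨_, _, _, h4, h5⟩ := hE q hqE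
      rcases Finset.mem_union.1 hq with hq | hq
      · rw [mem_arcs_induce] at hq
        exact h4 hq.2
      · obtain ⟨_, _, _, _, h6, h7⟩ := hLA q hq
        rcases h5 with h5 | h5
        · rw [cpi_in h5.1] at h6; exact h5.2 h6
        · rw [cpi_in h5.1] at h7; exact h5.2 h7
    · rw [Finset.disjoint_left]
      intro q hq hq'
      rw [mem_arcs_induce] at hq
      exact (hLA q hq').2.2.2.1 hq.2
  omega

lemma Ctr.TTsub (hc : Ctr D Q S r W) (hr : Rep S φ r) (hQ : Q ⊆ D.verts) :
    Subd (W.induce (W.verts \ S)) (D.induce (S ∪ W.verts)) := by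
  refine ⟨?_, ?_⟩
  · intro x hx
    have hx := (Finset.mem_inter.1 hx).1
    exact Finset.mem_inter.2 ⟨hQ (hc.sub hx), Finset.mem_union_right _ hx⟩
  · rintro x y ⟨h1, h2, h3⟩
    rw [Finset.mem_sdiff] at h2 h3
    exact ⟨hc.uu hr h1 h2.2 h3.2, Finset.mem_union_right _ h2.1, Finset.mem_union_right _ h3.1⟩

lemma Ctr.count (hc : Ctr D Q S r W) (hr : Rep S φ r) (hQ : Q ⊆ D.verts) (hSQ : S ⊆ Q)
    (E : Finset (ℕ × ℕ))
    (hE : ∀ e ∈ E, D.Adj e.1 e.2 ∧ e.1 ∈ S ∪ W.verts ∧ e.2 ∈ S ∪ W.verts ∧ ¬ (e.1 ∈ S ∧ e.2 ∈ S) ∧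
      ((e.1 ∈ S ∧ r e.1 ∉ W.verts) ∨ (e.2 ∈ S ∧ r e.2 ∉ W.verts))) :
    D.P (S ∪ W.verts) ≤ D.P S + W.pw + 2 * W.TT - 2 * (W.induce (W.verts \ S)).TT
      - 57 * (W.verts ∩ S).card + 17 * ((W.verts ∩ S).card * ((W.verts ∩ S).card - 1) : ℕ)
      - 17 * E.card := by
  have h1 := hc.arcs hr E hE
  have h2 : (D.induce S).TT + (W.induce (W.verts \ S)).TT ≤ (D.induce (S ∪ W.verts)).TT := by
    refine TT_add (induce_subd Finset.subset_union_left) (hc.TTsub hr hQ) ?_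
    rw [Finset.disjoint_left]
    intro x hx hx'
    exact (Finset.mem_sdiff.1 (Finset.mem_inter.1 hx').2).2 (Finset.mem_inter.1 hx).2
  have h3 := Finset.card_union_add_card_inter S W.verts
  have e1 := induce_verts (hSQ.trans hQ)
  have e2 := induce_verts (Finset.union_subset (hSQ.trans hQ) (hc.sub.trans hQ))
  rw [Finset.inter_comm] at h3
  unfold P pw
  rw [e1, e2]
  omega

lemma Ctr.TTk (W : Dgr) (S : Finset ℕ) :
    W.TT ≤ (W.induce (W.verts \ S)).TT + (W.verts ∩ S).card := by
  have := TT_sdiff W (W.verts ∩ S)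
  rwa [Finset.sdiff_inter_self_left] at this

lemma k4_arcs (hK : IsBidirComplete 4 W) : W.arcs.card = 12 := by
  have : W.arcs = W.verts.offDiag := by
    ext q
    rw [mem_arcs, Finset.mem_offDiag]
    exact ⟨fun h => ⟨(W.adj_mem h).1, (W.adj_mem h).2, fun e => W.adj_irrefl _ (e ▸ h)⟩,
      fun h => hK.2 _ h.1 _ h.2.1 h.2.2⟩
  rw [this, Finset.offDiag_card, hK.1]

lemma k4_TT (hK : IsBidirComplete 4 W) (hk : 1 ≤ (W.verts ∩ S).card) (hk3 : (W.verts ∩ S).card ≤ 3) :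
    3 ≤ (W.induce (W.verts \ S)).TT + (W.verts ∩ S).card := by
  have h := Finset.card_sdiff_add_card_inter W.verts S
  rw [hK.1] at h
  by_cases h3 : (W.verts ∩ S).card = 3
  · omega
  · have := TT_clq (D := W.induce (W.verts \ S)) (s := W.verts \ S) ⟨by omega,
      Finset.subset_inter Finset.sdiff_subset subset_rfl,
      fun u hu v hv huv => ⟨hK.2 u (Finset.mem_sdiff.1 hu).1 v (Finset.mem_sdiff.1 hv).1 huv, hu, hv⟩⟩
    omega

lemma Ctr.gap (hc : Ctr D Q S r W) (hr : Rep S φ r) (hQ : Q ⊆ D.verts) (hSQ : S ⊆ Q)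
    (hD : D.Crit) (hS : S.Nonempty) (hW : IsBidirComplete 4 W ∨ W.pw ≤ 17)
    (E : Finset (ℕ × ℕ))
    (hE : ∀ e ∈ E, D.Adj e.1 e.2 ∧ e.1 ∈ S ∪ W.verts ∧ e.2 ∈ S ∪ W.verts ∧ ¬ (e.1 ∈ S ∧ e.2 ∈ S) ∧
      ((e.1 ∈ S ∧ r e.1 ∉ W.verts) ∨ (e.2 ∈ S ∧ r e.2 ∉ W.verts))) :
    ((W.verts ∩ S).card = 1 ∧ D.P (S ∪ W.verts) ≤ D.P S - 37 - 17 * E.card) ∨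
    ((W.verts ∩ S).card = 2 ∧ D.P (S ∪ W.verts) ≤ D.P S - 58 - 17 * E.card) ∨
    ((W.verts ∩ S).card = 3 ∧ D.P (S ∪ W.verts) ≤ D.P S - 45 - 17 * E.card ∧
      (¬ IsBidirComplete 4 W → D.P (S ∪ W.verts) ≤ D.P S - 46 - 17 * E.card)) := by
  have h1 := hc.count hr hQ hSQ E hE
  have h2 := hc.le3 hr
  have h3 := hc.pos hr hD hQ hSQ hS
  have h4 := Ctr.TTk W S
  generalize hk : (W.verts ∩ S).card = k at *
  have hcase : W.pw ≤ 17 ∨ (W.pw + 2 * W.TT = 24 ∧ IsBidirComplete 4 W ∧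
      3 ≤ (W.induce (W.verts \ S)).TT + k) := by
    rcases hW with hW | hW
    · right
      refine ⟨?_, hW, ?_⟩
      · unfold pw
        rw [k4_arcs hW, hW.1]
        norm_num
      · rw [← hk]; exact k4_TT hW (by omega) (by omega)
    · exact Or.inl hW
  interval_cases k
  · left; refine ⟨rfl, ?_⟩; norm_num at h1; omega
  · right; left; refine ⟨rfl, ?_⟩; norm_num at h1; omega
  · right; right; norm_num at h1
    refine ⟨rfl, by omega, fun hK => ?_⟩
    rcases hcase with hc | hc
    · omega
    · exact absurd hc.2.1 hK
end
end Dgr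

namespace Dgr

/-- minimal counterexample -/
structure MC (D : Dgr) : Prop where
  crit : D.Crit
  nk4 : ¬ IsBidirComplete 4 D
  hp : 18 ≤ D.pw
  ih : ∀ W : Dgr, W.Crit → W.verts.card < D.verts.card → IsBidirComplete 4 W ∨ W.pw ≤ 17

lemma MC.rev {D : Dgr} (h : D.MC) : D.rev.MC :=
  ⟨h.crit.rev, fun hk => h.nk4 ⟨hk.1, fun u hu v hv huv => hk.2 v hv u hu huv.symm⟩,
    by rw [pw_rev]; exact h.hp, h.ih⟩

lemma MC.five {D : Dgr} (h : D.MC) : 5 ≤ D.verts.card := by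
  have h1 := h.crit.four_le
  have h2 : D.verts.card ≠ 4 := fun e => h.nk4 (h.crit.k4 e)
  omega

section
variable {D : Dgr} {Q S : Finset ℕ} {φ : ℕ → Fin 3} {r : ℕ → ℕ} {W : Dgr}

lemma ssub_card (hQ : Q ⊆ D.verts) (hne : Q ≠ D.verts) : Q.card < D.verts.card :=
  Finset.card_lt_card (Finset.ssubset_iff_subset_ne.2 ⟨hQ, hne⟩)

lemma MC.small1 (h : D.MC) (hc : Ctr D Q S r W) (hQ : Q ⊆ D.verts) (hne : Q ≠ D.verts) :
    IsBidirComplete 4 W ∨ W.pw ≤ 17 :=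
  h.ih W hc.crit (lt_of_le_of_lt (Finset.card_le_card hc.sub) (ssub_card hQ hne))

lemma MC.small2 (h : D.MC) (hc : Ctr D D.verts S r W) (hr : Rep S φ r) (hS : S ⊆ D.verts)
    (h4 : 4 ≤ S.card) : IsBidirComplete 4 W ∨ W.pw ≤ 17 := by
  refine h.ih W hc.crit ?_
  have h1 := Finset.card_union_add_card_inter S W.verts
  have h2 := Finset.card_le_card (Finset.union_subset hS hc.sub)
  have h3 := hc.le3 hr
  rw [Finset.inter_comm] at h1
  omega

lemma MC.lem2 (h : D.MC) : ∀ S, S ⊆ D.verts → S ≠ D.verts → 4 ≤ S.card → D.pw + 37 ≤ D.P S := by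
  classical
  by_contra hcon
  push Not at hcon
  obtain ⟨S1, h1, h2, h3, h4⟩ := hcon
  obtain ⟨S, hS, hmin⟩ := Finset.exists_min_image
    (D.verts.powerset.filter (fun S => S ≠ D.verts ∧ 4 ≤ S.card)) D.P
    ⟨S1, Finset.mem_filter.2 ⟨Finset.mem_powerset.2 h1, h2, h3⟩⟩
  have h5 := hmin S1 (Finset.mem_filter.2 ⟨Finset.mem_powerset.2 h1, h2, h3⟩)
  obtain ⟨hS1, hS2, hS3⟩ := Finset.mem_filter.1 hS
  rw [Finset.mem_powerset] at hS1
  obtain ⟨φ, hφ⟩ := h.crit.exists_col hS1 hS2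
  obtain ⟨r, hr⟩ := exists_rep S φ
  obtain ⟨W, hc⟩ := contract hS1 hφ hr (fun ψ h1 _ => h.crit.not_col ψ h1)
  have hg := hc.gap hr subset_rfl hS1 h.crit (Finset.card_pos.1 (by omega)) (h.small2 hc hr hS1 hS3) ∅
    (by simp)
  simp only [Finset.card_empty] at hg
  have hP : D.P (S ∪ W.verts) ≤ D.P S - 37 := by omega
  by_cases hR : S ∪ W.verts = D.verts
  · rw [hR, P_verts] at hP
    omega
  · have := hmin (S ∪ W.verts) (Finset.mem_filter.2 ⟨Finset.mem_powerset.2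
      (Finset.union_subset hS1 hc.sub), hR, hS3.trans (Finset.card_le_card Finset.subset_union_left)⟩)
    omega

lemma MC.lemDig (h : D.MC) (hS : S ⊆ D.verts) (hne : S ≠ D.verts) {u v : ℕ} (hu : u ∈ S)
    (hv : v ∈ S) (huv : u ≠ v) : ∃ φ, D.Col S φ ∧ φ u ≠ φ v := by
  classical
  have hiv := induce_verts hS
  by_cases hcol : ((D.induce S).addDigon u v).Dicolourable 3
  · obtain ⟨φ, hφ⟩ := hcol
    refine ⟨φ, acy_mono (fun a b h' => ⟨Or.inl h'.1, h'.2⟩) hφ, fun e => ?_⟩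
    refine hφ u ((Relation.TransGen.single (b := v) ⟨Or.inr ⟨huv, ?_, ?_, Or.inl ⟨rfl, rfl⟩⟩, e⟩).tail
      ⟨Or.inr ⟨huv, ?_, ?_, Or.inr ⟨rfl, rfl⟩⟩, e.symm⟩) <;> rw [hiv] <;> assumption
  · exfalso
    obtain ⟨W, hs, hW⟩ := exists_crit _ hcol
    have hWS : W.verts ⊆ S := by rw [← hiv]; exact hs.1
    have hWlt : W.verts.card < D.verts.card :=
      lt_of_le_of_lt (Finset.card_le_card hWS) (ssub_card hS hne)
    have hWne : W.verts ≠ D.verts := fun e => by rw [e] at hWlt; exact lt_irrefl _ hWlt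
    have hadj : ∀ a b, W.Adj a b → ¬ (a = u ∧ b = v) → ¬ (a = v ∧ b = u) → D.Adj a b := by
      intro a b hab h1 h2
      rcases hs.2 hab with h3 | ⟨_, _, _, h3 | h3⟩
      · exact h3.1
      · exact absurd h3 h1
      · exact absurd h3 h2
    have huW : u ∈ W.verts := by
      by_contra hn
      refine h.crit.no_sub hW ⟨hWS.trans hS, fun a b hab => hadj a b hab ?_ ?_⟩ hWne
      · rintro ⟨rfl, rfl⟩; exact hn (W.adj_mem hab).1
      · rintro ⟨rfl, rfl⟩; exact hn (W.adj_mem hab).2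
    have hT := TT_digon (D := W) (H := D.induce W.verts) u v
      (by rw [induce_verts (hWS.trans hS)]) (fun a b hab h1 h2 => ⟨hadj a b hab h1 h2, W.adj_mem hab⟩)
    have hA : W.arcs.card ≤ (D.induce W.verts).arcs.card + 2 := by
      have : W.arcs ⊆ (D.induce W.verts).arcs ∪ {(u, v), (v, u)} := by
        intro q hq
        have hq' := mem_arcs.1 hq
        by_cases h1 : q.1 = u ∧ q.2 = v
        · exact Finset.mem_union_right _ (by simp [← h1.1, ← h1.2])
        · by_cases h2 : q.1 = v ∧ q.2 = u
          · exact Finset.mem_union_right _ (by simp [← h2.1, ← h2.2])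
          · exact Finset.mem_union_left _ (mem_arcs_induce.2 ⟨hadj _ _ hq' h1 h2, W.adj_mem hq'⟩)
      have h1 := Finset.card_le_card this
      have h2 := Finset.card_union_le (D.induce W.verts).arcs {(u, v), (v, u)}
      have h3 : ({(u, v), (v, u)} : Finset (ℕ × ℕ)).card ≤ 2 := Finset.card_le_two
      omega
    have hl0 := h.lem2 W.verts (hWS.trans hS) hWne hW.four_le
    have hp := h.hp
    have hl2 : 55 ≤ D.P W.verts := by omega
    unfold P pw at hl2
    rw [induce_verts (hWS.trans hS)] at hl2
    rcases h.ih W hW hWlt with hK | hK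
    · have : (D.induce W.verts).Clq (W.verts.erase u) := by
        refine ⟨Or.inr (by rw [Finset.card_erase_of_mem huW, hK.1]), ?_, ?_⟩
        · rw [induce_verts (hWS.trans hS)]; exact Finset.erase_subset _ _
        · intro a ha b hb hab
          rw [Finset.mem_erase] at ha hb
          exact ⟨hadj a b (hK.2 a ha.2 b hb.2 hab) (fun e => ha.1 e.1) (fun e => hb.1 e.2), ha.2, hb.2⟩
      have ht := TT_clq this
      rw [Finset.card_erase_of_mem huW, hK.1] at ht
      rw [k4_arcs hK] at hA
      rw [hK.1] at hl2
      omega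
    · unfold pw at hK
      omega

/-- boundary vertex -/
def Bd (D : Dgr) (S : Finset ℕ) (u : ℕ) : Prop := ∃ w ∈ D.verts, w ∉ S ∧ (D.Adj u w ∨ D.Adj w u)

lemma MC.boundary (h : D.MC) (hS : S ⊆ D.verts) (hne : S ≠ D.verts) (h2 : 2 ≤ S.card) :
    ∃ u ∈ S, ∃ v ∈ S, u ≠ v ∧ D.Bd S u ∧ D.Bd S v := by
  classical
  by_contra hcon
  push Not at hcon
  obtain ⟨u, hu, hall⟩ : ∃ u ∈ S, ∀ v ∈ S, D.Bd S v → v = u := by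
    by_cases hb : ∃ u ∈ S, D.Bd S u
    · obtain ⟨u, hu, hbu⟩ := hb
      refine ⟨u, hu, fun v hv hbv => ?_⟩
      by_contra hvu
      exact hcon v hv u hu hvu hbv hbu
    · push Not at hb
      obtain ⟨u, hu⟩ := Finset.card_pos.1 (show 0 < S.card by omega)
      exact ⟨u, hu, fun v hv hbv => absurd hbv (hb v hv)⟩
  obtain ⟨φ, hφ⟩ := h.crit.exists_col hS hne
  obtain ⟨r, hr, hru⟩ := exists_rep_at S φ hu
  obtain ⟨W, hc⟩ := contract hS hφ hr (fun ψ h1 _ => h.crit.not_col ψ h1)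
  have hX : ∀ a ∈ W.verts, a ∈ S → a = u := by
    intro a ha haS
    have h3 := hc.crit.dout_ge ha
    have hle := hc.le3 hr
    have : ¬ (W.verts.filter (fun b => W.Adj a b) ⊆ (W.verts ∩ S).erase a) := by
      intro hsub
      have h5 := Finset.card_le_card hsub
      rw [Finset.card_erase_of_mem (Finset.mem_inter.2 ⟨ha, haS⟩)] at h5
      unfold dout at h3
      have h6 : 3 ≤ (W.verts.filter (fun b => W.Adj a b)).card := by convert h3
      omega
    rw [Finset.not_subset] at this
    obtain ⟨b, hb, hb'⟩ := this
    rw [Finset.mem_filter] at hb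
    have hbS : b ∉ S := fun hbS => hb' (Finset.mem_erase.2
      ⟨fun e => W.adj_irrefl a (e ▸ hb.2), Finset.mem_inter.2 ⟨hb.1, hbS⟩⟩)
    obtain ⟨v, hv, hrv, hvb⟩ := hc.su hr hb.2 haS hbS
    have := hall v hv ⟨b, hc.sub hb.1, hbS, Or.inl hvb⟩
    rw [← hrv, this, hru]
  obtain ⟨w, hw, hwu⟩ := Finset.exists_mem_ne (show 1 < S.card by omega) u
  refine h.crit.no_sub hc.crit ⟨hc.sub, fun a b hab => ?_⟩ (fun e => hwu (hX w (e ▸ hS hw) hw))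
  obtain ⟨ha, hb⟩ := W.adj_mem hab
  by_cases haS : a ∈ S <;> by_cases hbS : b ∈ S
  · rw [hX a ha haS, hX b hb hbS] at hab
    exact absurd hab (W.adj_irrefl _)
  · obtain ⟨v, hv, _, hvb⟩ := hc.su hr hab haS hbS
    rw [hX a ha haS, ← hall v hv ⟨b, hc.sub hb, hbS, Or.inl hvb⟩]
    exact hvb
  · obtain ⟨v, hv, _, hvb⟩ := hc.us hr hab haS hbS
    rw [hX b hb hbS, ← hall v hv ⟨a, hc.sub ha, haS, Or.inr hvb⟩]
    exact hvb
  · exact hc.uu hr hab haS hbS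

lemma MC.lem3 (h : D.MC) (hS : S ⊆ D.verts) (hne : S ≠ D.verts) (h4 : 4 ≤ S.card) :
    D.pw + 45 ≤ D.P S ∧ (S.card + 2 ≤ D.verts.card → D.pw + 46 ≤ D.P S) := by
  classical
  obtain ⟨u, hu, v, hv, huv, hbu, hbv⟩ := h.boundary hS hne (by omega)
  obtain ⟨φ, hφ, hφuv⟩ := h.lemDig hS hne hu hv huv
  obtain ⟨r, hr⟩ := exists_rep S φ
  obtain ⟨W, hc⟩ := contract hS hφ hr (fun ψ h1 _ => h.crit.not_col ψ h1)
  have hSn : S.Nonempty := ⟨u, hu⟩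
  have hg := hc.gap hr subset_rfl hS h.crit hSn (h.small2 hc hr hS h4) ∅ (by simp)
  simp only [Finset.card_empty] at hg
  by_cases hR : S ∪ W.verts = D.verts
  · rcases hg with ⟨hk, hg⟩ | ⟨hk, hg⟩ | ⟨hk, hg, hg'⟩
    · obtain ⟨a, ha⟩ := Finset.card_eq_one.1 hk
      obtain ⟨x, hx, hbx, hxa⟩ : ∃ x ∈ S, D.Bd S x ∧ φ x ≠ φ a := by
        by_cases hua : φ u = φ a
        · exact ⟨v, hv, hbv, fun e => hφuv (hua.trans e.symm)⟩
        · exact ⟨u, hu, hbu, hua⟩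
      have hrx : r x ∉ W.verts := by
        intro hrx
        have : r x ∈ W.verts ∩ S := Finset.mem_inter.2 ⟨hrx, (hr.1 x hx).1⟩
        rw [ha, Finset.mem_singleton] at this
        exact hxa (by rw [← this, (hr.1 x hx).2])
      obtain ⟨w, hw, hwS, hxw⟩ := hbx
      have hE : ∃ E : Finset (ℕ × ℕ), E.card = 1 ∧ ∀ e ∈ E, D.Adj e.1 e.2 ∧ e.1 ∈ S ∪ W.verts ∧
          e.2 ∈ S ∪ W.verts ∧ ¬ (e.1 ∈ S ∧ e.2 ∈ S) ∧
          ((e.1 ∈ S ∧ r e.1 ∉ W.verts) ∨ (e.2 ∈ S ∧ r e.2 ∉ W.verts)) := by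
        rw [hR]
        rcases hxw with hxw | hxw
        · refine ⟨{(x, w)}, Finset.card_singleton _, fun e he => ?_⟩
          rw [Finset.mem_singleton] at he
          subst he
          exact ⟨hxw, hS hx, hw, fun e => hwS e.2, Or.inl ⟨hx, hrx⟩⟩
        · refine ⟨{(w, x)}, Finset.card_singleton _, fun e he => ?_⟩
          rw [Finset.mem_singleton] at he
          subst he
          exact ⟨hxw, hw, hS hx, fun e => hwS e.1, Or.inr ⟨hx, hrx⟩⟩
      obtain ⟨E, hE1, hE2⟩ := hE
      have hg2 := hc.gap hr subset_rfl hS h.crit hSn (h.small2 hc hr hS h4) E hE2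
      rw [hE1, hR, P_verts, hk] at hg2
      push_cast at hg2
      constructor <;> omega
    · rw [hR, P_verts] at hg
      constructor <;> omega
    · rw [hR, P_verts] at hg hg'
      refine ⟨by omega, fun hcard => ?_⟩
      have hnk : ¬ IsBidirComplete 4 W := by
        intro hK
        have h1 := Finset.card_union_add_card_inter S W.verts
        rw [hR, Finset.inter_comm, hk, hK.1] at h1
        omega
      have := hg' hnk
      push_cast at this
      omega
  · have := h.lem2 (S ∪ W.verts) (Finset.union_subset hS hc.sub) hR
      (h4.trans (Finset.card_le_card Finset.subset_union_left))
    constructor <;> omega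

lemma MC.ext (h : D.MC) (hQ : Q ⊆ D.verts) (hne : Q ≠ D.verts) (hSQ : S ⊆ Q) (hSn : S.Nonempty)
    (hφ : D.Col S φ) (hP : D.P S ≤ 99) : ∃ ψ, D.Col Q ψ ∧ ∀ v ∈ S, ψ v = φ v := by
  by_contra hcon
  push Not at hcon
  obtain ⟨r, hr⟩ := exists_rep S φ
  obtain ⟨W, hc⟩ := contract hSQ hφ hr (fun ψ h1 h2 => by
    obtain ⟨v, hv, hn⟩ := hcon ψ h1
    exact hn (h2 v hv))
  have hg := hc.gap hr hQ hSQ h.crit hSn (h.small1 hc hQ hne) ∅ (by simp)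
  simp only [Finset.card_empty] at hg
  have hRQ : S ∪ W.verts ⊆ Q := Finset.union_subset hSQ hc.sub
  have := (h.lem3 (hRQ.trans hQ) (fun e => hne (hQ.antisymm (e ▸ hRQ)))
    (hc.crit.four_le.trans (Finset.card_le_card Finset.subset_union_right))).1
  have := h.hp
  omega

lemma P_le (hS : S ⊆ D.verts) {a t : ℕ} (ha : a ≤ (D.induce S).arcs.card) (ht : t ≤ (D.induce S).TT) :
    D.P S ≤ 57 * S.card - 17 * a - 2 * t := by
  unfold P pw
  rw [induce_verts hS]
  omega

/-- all pairs but ad are digons -/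
lemma MC.no_diamond (h : D.MC) {a b c d : ℕ} (had : a ≠ d) (hab : D.Dig a b) (hac : D.Dig a c)
    (hbc : D.Dig b c) (hbd : D.Dig b d) (hcd : D.Dig c d) : False := by
  have s1 := arcs_insert (D := D) (S := {d}) (y := c) (by simpa using hcd.ne) {d} {d} subset_rfl subset_rfl
    (by simpa using hcd.1) (by simpa using hcd.2)
  have s2 := arcs_insert (D := D) (S := {c, d}) (y := b) (by simp [hbc.ne, hbd.ne]) {c, d} {c, d}
    subset_rfl subset_rfl (by simp [hbc.1, hbd.1]) (by simp [hbc.2, hbd.2])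
  have s3 := arcs_insert (D := D) (S := {b, c, d}) (y := a) (by simp [hab.ne, hac.ne, had]) {b, c} {b, c}
    (by intro x; simp; tauto) (by intro x; simp; tauto) (by simp [hab.1, hac.1]) (by simp [hab.2, hac.2])
  rw [Finset.card_pair hcd.ne] at s2
  rw [Finset.card_pair hbc.ne] at s3
  rw [Finset.card_singleton] at s1
  have hcard : ({a, b, c, d} : Finset ℕ).card = 4 := by
    rw [Finset.card_insert_of_notMem (by simp [hab.ne, hac.ne, had]),
      Finset.card_insert_of_notMem (by simp [hbc.ne, hbd.ne]), Finset.card_pair hcd.ne]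
  have hsub : ({a, b, c, d} : Finset ℕ) ⊆ D.verts := by
    intro x hx
    simp only [Finset.mem_insert, Finset.mem_singleton] at hx
    rcases hx with rfl | rfl | rfl | rfl
    · exact (D.adj_mem hab.1).1
    · exact (D.adj_mem hab.1).2
    · exact (D.adj_mem hac.1).2
    · exact (D.adj_mem hbd.1).2
  have hT : 2 ≤ (D.induce {a, b, c, d}).TT := by
    have hd : ∀ x y, D.Dig x y → x ∈ ({a, b, c, d} : Finset ℕ) → y ∈ ({a, b, c, d} : Finset ℕ) →
      (D.induce {a, b, c, d}).Dig x y := fun x y h hx hy => ⟨⟨h.1, hx, hy⟩, ⟨h.2, hy, hx⟩⟩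
    have := TT_clq (clq_triple (hd a b hab (by simp) (by simp)) (hd a c hac (by simp) (by simp))
      (hd b c hbc (by simp) (by simp)))
    rwa [Finset.card_eq_three.2 ⟨a, b, c, hab.ne, hac.ne, hbc.ne, rfl⟩] at this
  have h1 := P_le (D := D) hsub (a := 10) (by omega) hT
  have h5 := h.five
  have h2 := (h.lem3 hsub (fun e => by rw [e] at hcard; omega) (by omega)).1
  have := h.hp
  rw [hcard] at h1
  omega

lemma P_pair {a b : ℕ} (hxy : D.Adj a b) : D.P {a, b} ≤ 97 := by
  have hne : a ≠ b := fun e => D.adj_irrefl b (e ▸ hxy)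
  have hsub : ({a, b} : Finset ℕ) ⊆ D.verts := by
    intro x hx
    simp only [Finset.mem_insert, Finset.mem_singleton] at hx
    rcases hx with rfl | rfl
    · exact (D.adj_mem hxy).1
    · exact (D.adj_mem hxy).2
  have s1 := arcs_insert (D := D) (S := {b}) (y := a) (by simpa using hne) {b} ∅ subset_rfl (by simp)
    (by simpa using hxy) (by simp)
  rw [Finset.card_singleton] at s1
  have := P_le (D := D) hsub (a := 1) (t := 0) (by omega) (by omega)
  rw [Finset.card_pair hne] at this
  omega
end
end Dgr

namespace Dgr

section
variable {D : Dgr} {Q S : Finset ℕ} {φ : ℕ → Fin 3} {r : ℕ → ℕ} {W : Dgr}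

lemma dout3 {x p : ℕ} (h : D.dout x = 3) (hp : D.Adj x p) : ∃ q s, q ≠ p ∧ s ≠ p ∧ q ≠ s ∧
    D.Adj x q ∧ D.Adj x s ∧ ∀ u, D.Adj x u → u = p ∨ u = q ∨ u = s := by
  classical
  have h3 : (D.verts.filter (fun u => D.Adj x u)).card = 3 := by unfold dout at h; convert h
  have hpm : p ∈ D.verts.filter (fun u => D.Adj x u) := Finset.mem_filter.2 ⟨(D.adj_mem hp).2, hp⟩
  have h2 : ((D.verts.filter (fun u => D.Adj x u)).erase p).card = 2 := by
    rw [Finset.card_erase_of_mem hpm, h3]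
  obtain ⟨q, s, hqs, he⟩ := Finset.card_eq_two.1 h2
  have hq : q ∈ (D.verts.filter (fun u => D.Adj x u)).erase p := by rw [he]; simp
  have hs : s ∈ (D.verts.filter (fun u => D.Adj x u)).erase p := by rw [he]; simp
  rw [Finset.mem_erase, Finset.mem_filter] at hq hs
  refine ⟨q, s, hq.1, hs.1, hqs, hq.2.2, hs.2.2, fun u hu => ?_⟩
  by_cases hup : u = p
  · exact Or.inl hup
  · right
    have : u ∈ (D.verts.filter (fun u => D.Adj x u)).erase p :=
      Finset.mem_erase.2 ⟨hup, Finset.mem_filter.2 ⟨(D.adj_mem hu).2, hu⟩⟩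
    rw [he] at this
    simpa using this

lemma dout3' {x p q : ℕ} (h : D.dout x = 3) (hp : D.Adj x p) (hq : D.Adj x q) (hpq : q ≠ p) :
    ∃ s, s ≠ p ∧ s ≠ q ∧ D.Adj x s ∧ ∀ u, D.Adj x u → u = p ∨ u = q ∨ u = s := by
  obtain ⟨a, b, h1, h2, h3, h4, h5, h6⟩ := dout3 h hp
  rcases h6 q hq with e | rfl | rfl
  · exact absurd e hpq
  · exact ⟨b, h2, h3.symm, h5, h6⟩
  · exact ⟨a, h1, h3, h4, fun u hu => by rcases h6 u hu with h | h | h <;> tauto⟩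

lemma din3 {x p : ℕ} (h : D.din x = 3) (hp : D.Adj p x) : ∃ q s, q ≠ p ∧ s ≠ p ∧ q ≠ s ∧
    D.Adj q x ∧ D.Adj s x ∧ ∀ u, D.Adj u x → u = p ∨ u = q ∨ u = s :=
  dout3 (D := D.rev) h hp

lemma din3' {x p q : ℕ} (h : D.din x = 3) (hp : D.Adj p x) (hq : D.Adj q x) (hpq : q ≠ p) :
    ∃ s, s ≠ p ∧ s ≠ q ∧ D.Adj s x ∧ ∀ u, D.Adj u x → u = p ∨ u = q ∨ u = s :=
  dout3' (D := D.rev) h hp hq hpq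

lemma Col.empty (D : Dgr) (φ : ℕ → Fin 3) : D.Col ∅ φ := by
  intro v hv
  rcases Relation.TransGen.tail'_iff.1 hv with ⟨b, _, hb⟩
  exact absurd hb.1.2.1 (Finset.notMem_empty _)

lemma Col.ins (h : D.Col Q φ) {v : ℕ} (hv : v ∉ Q)
    (hc : (∀ u ∈ Q, D.Adj u v → φ u ≠ φ v) ∨ (∀ u ∈ Q, D.Adj v u → φ u ≠ φ v)) :
    D.Col (insert v Q) φ := by
  rcases hc with hc | hc
  · have := h.extend_in hv hc
    rwa [Function.update_eq_self] at this
  · have := h.extend_out hv hc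
    rwa [Function.update_eq_self] at this

lemma col_pair {s t : ℕ} (hst : s ≠ t) (hd : ¬ D.Dig s t) (φ : ℕ → Fin 3) : D.Col {s, t} φ := by
  have h1 : D.Col {t} φ := (Col.empty D φ).ins (Finset.notMem_empty t) (Or.inl (by simp))
  refine h1.ins (by simpa using hst) ?_
  by_cases h : D.Adj s t
  · left
    intro u hu hus
    rw [Finset.mem_singleton] at hu
    subst hu
    exact absurd ⟨h, hus⟩ hd
  · right
    intro u hu hus
    rw [Finset.mem_singleton] at hu
    subst hu
    exact absurd hus h

lemma fin3_aux : ∀ a b c : Fin 3, (∀ d, d = a ∨ d = b ∨ d = c) → a ≠ b ∧ a ≠ c := by decide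

lemma two_color (a b : Fin 3) : ∃ c, c ≠ a ∧ c ≠ b := by revert a b; decide

lemma erase_ne {y : ℕ} (hy : y ∈ D.verts) : D.verts.erase y ≠ D.verts :=
  fun e => Finset.notMem_erase y D.verts (by rw [e]; exact hy)

lemma MC.claimA (h : D.MC) {x y a : ℕ} (hx : D.dout x = 3) (hy : D.din y = 3) (hxy : D.Adj x y)
    (hxa : D.Adj x a) (hay : a ≠ y) : D.Adj a x := by
  by_contra hax
  have hyV := (D.adj_mem hxy).2
  have hxV := (D.adj_mem hxy).1
  have hne : x ≠ y := fun e => D.adj_irrefl y (e ▸ hxy)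
  have hxane : x ≠ a := fun e => D.adj_irrefl a (e ▸ hxa)
  have hS : ({x, a} : Finset ℕ) ⊆ D.verts.erase y := by
    intro v hv
    simp only [Finset.mem_insert, Finset.mem_singleton] at hv
    rcases hv with rfl | rfl
    · exact Finset.mem_erase.2 ⟨hne, hxV⟩
    · exact Finset.mem_erase.2 ⟨hay, (D.adj_mem hxa).2⟩
  obtain ⟨ψ, hψ, hag⟩ := h.ext (Finset.erase_subset y D.verts) (erase_ne hyV) hS ⟨x, by simp⟩
    (col_pair hxane (fun h' => hax h'.2) (fun _ => 0)) ((P_pair hxa).trans (by norm_num))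
  have hψxa : ψ x = ψ a := by rw [hag x (by simp), hag a (by simp)]
  obtain ⟨z, w, hzx, hwx, hzw, hz, hw, hin⟩ := din3 hy hxy
  obtain ⟨b, hby, hba, hb, hout⟩ := dout3' hx hxy hxa hay
  have hall : ∀ d, d = ψ x ∨ d = ψ z ∨ d = ψ w := by
    intro d
    by_contra hd
    push Not at hd
    have := hψ.extend_in (v := y) (c := d) (Finset.notMem_erase _ _) (by
      intro u _ huy
      rcases hin u huy with rfl | rfl | rfl
      · exact hd.1.symm
      · exact hd.2.1.symm
      · exact hd.2.2.symm)
    rw [Finset.insert_erase hyV] at this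
    exact h.crit.not_col _ this
  obtain ⟨h1, h2⟩ := fin3_aux _ _ _ hall
  obtain ⟨c, hca, hcb⟩ := two_color (ψ a) (ψ b)
  have hxm : x ∈ D.verts.erase y := Finset.mem_erase.2 ⟨hne, hxV⟩
  have h3 := (hψ.mono (Finset.erase_subset x _)).extend_out (v := x) (c := c) (Finset.notMem_erase _ _) (by
    intro u hu hxu
    rcases hout u hxu with rfl | rfl | rfl
    · exact absurd (Finset.mem_of_mem_erase hu) (Finset.notMem_erase _ _)
    · exact hca.symm
    · exact hcb.symm)
  rw [Finset.insert_erase hxm] at h3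
  have h4 := h3.extend_in (v := y) (c := ψ x) (Finset.notMem_erase _ _) (by
    intro u _ huy
    rcases hin u huy with rfl | rfl | rfl
    · rw [Function.update_self, hψxa]; exact hca
    · rw [Function.update_of_ne hzx]; exact h1.symm
    · rw [Function.update_of_ne hwx]; exact h2.symm)
  rw [Finset.insert_erase hyV] at h4
  exact h.crit.not_col _ h4

lemma MC.claimA' (h : D.MC) {x y a : ℕ} (hx : D.dout x = 3) (hy : D.din y = 3) (hxy : D.Adj x y)
    (hay : D.Adj a y) (hax : a ≠ x) : D.Adj y a :=
  h.rev.claimA (x := y) (y := x) (a := a) hy hx hxy hay hax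

lemma perm3 (p q w : ℕ) : ({p, q, w} : Finset ℕ) = {w, p, q} := by
  ext a; simp only [Finset.mem_insert, Finset.mem_singleton]; tauto

lemma pigeon3 {a b c a' b' c' : Prop} (h1 : ¬ (a ∧ b) ∧ ¬ (a ∧ c) ∧ ¬ (b ∧ c))
    (h2 : ¬ (a' ∧ b') ∧ ¬ (a' ∧ c') ∧ ¬ (b' ∧ c')) (ha : ¬ a → ¬ a' → False)
    (hb : ¬ b → ¬ b' → False) (hc : ¬ c → ¬ c' → False) : False := by
  tauto

set_option maxHeartbeats 2000000 in
lemma MC.lemC (h : D.MC) {y s t u : ℕ} (hin : ∀ v, D.Adj v y → v = s ∨ v = t ∨ v = u)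
    (hys : D.Dig y s) (hyt : D.Dig y t) (hyu : D.Dig y u) (hu : D.dout u = 3)
    (hst : s ≠ t) (hus : u ≠ s) (hut : u ≠ t) (hnd : ¬ D.Dig s t) :
    D.din u = 3 ∧ ∃ W : Dgr, (∀ v ∈ W.verts, v ∈ D.verts ∧ v ≠ y ∧ v ≠ u ∧ v ≠ t) ∧
      (∀ a b, W.Adj a b → a ≠ s → b ≠ s → D.Adj a b) ∧
      (∀ a, W.Adj a s → D.Adj a s ∨ D.Adj a t) ∧ (∀ a, W.Adj s a → D.Adj s a ∨ D.Adj t a) ∧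
      D.TT ≤ W.TT := by
  classical
  have hyV := (D.adj_mem hys.1).1
  have hsV := (D.adj_mem hys.1).2
  have htV := (D.adj_mem hyt.1).2
  have huV := (D.adj_mem hyu.1).2
  set Q := (D.verts.erase y).erase u with hQdef
  have hum : u ∈ D.verts.erase y := Finset.mem_erase.2 ⟨hyu.ne.symm, huV⟩
  have hQ : Q ⊆ D.verts := (Finset.erase_subset _ _).trans (Finset.erase_subset _ _)
  have hyQ : y ∉ Q := fun hh => Finset.notMem_erase y D.verts (Finset.mem_of_mem_erase hh)
  have huQ : u ∉ Q := Finset.notMem_erase _ _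
  have hQne : Q ≠ D.verts := fun e => hyQ (e ▸ hyV)
  have hsQ : s ∈ Q := Finset.mem_erase.2 ⟨hus.symm, Finset.mem_erase.2 ⟨hys.ne.symm, hsV⟩⟩
  have htQ : t ∈ Q := Finset.mem_erase.2 ⟨hut.symm, Finset.mem_erase.2 ⟨hyt.ne.symm, htV⟩⟩
  have hSQ : ({s, t} : Finset ℕ) ⊆ Q := by
    intro v hv
    simp only [Finset.mem_insert, Finset.mem_singleton] at hv
    rcases hv with rfl | rfl <;> assumption
  have claim1 : ∀ ψ, D.Col Q ψ → ψ s = ψ t → False := by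
    intro ψ hψ he
    obtain ⟨p, q, hpy, hqy, hpq, hup, huq, hout⟩ := dout3 hu hyu.2
    obtain ⟨c, hc1, hc2⟩ := two_color (ψ p) (ψ q)
    have h3 := hψ.extend_out (v := u) (c := c) huQ (by
      intro v hv huv
      rcases hout v huv with rfl | rfl | rfl
      · exact absurd hv hyQ
      · exact hc1.symm
      · exact hc2.symm)
    rw [Finset.insert_erase hum] at h3
    obtain ⟨c', hc1', hc2'⟩ := two_color (ψ s) c
    have h4 := h3.extend_in (v := y) (c := c') (Finset.notMem_erase _ _) (by
      intro v _ huy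
      rcases hin v huy with rfl | rfl | rfl
      · rw [Function.update_of_ne hus.symm]; exact hc1'.symm
      · rw [Function.update_of_ne hut.symm, ← he]; exact hc1'.symm
      · rw [Function.update_self]; exact hc2'.symm)
    rw [Finset.insert_erase hyV] at h4
    exact h.crit.not_col _ h4
  have hcst := col_pair hst hnd (fun _ => (0 : Fin 3))
  have hnadj : ¬ D.Adj s t ∧ ¬ D.Adj t s := by
    have key : D.P {s, t} ≤ 97 → False := by
      intro hP
      obtain ⟨ψ, hψ, hag⟩ := h.ext hQ hQne hSQ ⟨s, by simp⟩ hcst (hP.trans (by norm_num))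
      exact claim1 ψ hψ (by rw [hag s (by simp), hag t (by simp)])
    refine ⟨fun e => key (P_pair e), fun e => key ?_⟩
    rw [Finset.pair_comm]
    exact P_pair e
  have hr : Rep {s, t} (fun _ => (0 : Fin 3)) (fun _ => s) :=
    ⟨fun v _ => ⟨by simp, rfl⟩, fun _ _ _ _ _ => rfl⟩
  obtain ⟨W, hc⟩ := contract hSQ hcst hr (fun ψ h1 h2 => claim1 ψ h1 (by
    rw [h2 s (by simp), h2 t (by simp)]))
  have htW : t ∉ W.verts := fun htW => hst (hc.fix t htW (by simp))
  have hpos := hc.pos hr h.crit hQ hSQ ⟨s, by simp⟩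
  have hsW : s ∈ W.verts := by
    obtain ⟨a, ha⟩ := Finset.card_pos.1 (show 0 < (W.verts ∩ {s, t}).card by omega)
    rw [Finset.mem_inter] at ha
    have := hc.fix a ha.1 ha.2
    exact this ▸ ha.1
  have hWS : W.verts ∩ {s, t} = {s} := by
    ext v
    simp only [Finset.mem_inter, Finset.mem_insert, Finset.mem_singleton]
    constructor
    · rintro ⟨h1, rfl | rfl⟩
      · rfl
      · exact absurd h1 htW
    · rintro rfl
      exact ⟨hsW, Or.inl rfl⟩
  have hWd : W.verts \ {s, t} = W.verts.erase s := by
    ext v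
    simp only [Finset.mem_sdiff, Finset.mem_insert, Finset.mem_singleton, Finset.mem_erase]
    constructor
    · rintro ⟨h1, h2⟩
      exact ⟨fun e => h2 (Or.inl e), h1⟩
    · rintro ⟨h1, h2⟩
      exact ⟨h2, fun e => e.elim h1 (fun e => htW (e ▸ h2))⟩
  have hk : (W.verts ∩ {s, t}).card = 1 := by rw [hWS, Finset.card_singleton]
  have memS : ∀ v ∈ W.verts, v ≠ s → v ∉ ({s, t} : Finset ℕ) := by
    intro v hv hvs hm
    simp only [Finset.mem_insert, Finset.mem_singleton] at hm
    exact hm.elim hvs (fun e => htW (e ▸ hv))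
  have hWQ : ∀ v ∈ W.verts, v ∈ D.verts ∧ v ≠ y ∧ v ≠ u ∧ v ≠ t := fun v hv =>
    ⟨hQ (hc.sub hv), fun e => hyQ (e ▸ hc.sub hv), fun e => huQ (e ▸ hc.sub hv), fun e => htW (e ▸ hv)⟩
  have huu : ∀ a b, W.Adj a b → a ≠ s → b ≠ s → D.Adj a b := fun a b hab ha hb =>
    hc.uu hr hab (memS a (W.adj_mem hab).1 ha) (memS b (W.adj_mem hab).2 hb)
  have hus' : ∀ a, W.Adj a s → D.Adj a s ∨ D.Adj a t := by
    intro a ha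
    obtain ⟨v, hv, _, hav⟩ := hc.us hr ha (memS a (W.adj_mem ha).1
      (fun e => W.adj_irrefl _ (e ▸ ha))) (by simp)
    simp only [Finset.mem_insert, Finset.mem_singleton] at hv
    rcases hv with rfl | rfl
    · exact Or.inl hav
    · exact Or.inr hav
  have hsu' : ∀ a, W.Adj s a → D.Adj s a ∨ D.Adj t a := by
    intro a ha
    obtain ⟨v, hv, _, hav⟩ := hc.su hr ha (by simp) (memS a (W.adj_mem ha).2
      (fun e => W.adj_irrefl _ (e ▸ ha)))
    simp only [Finset.mem_insert, Finset.mem_singleton] at hv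
    rcases hv with rfl | rfl
    · exact Or.inl hav
    · exact Or.inr hav
  have hS2 : ({s, t} : Finset ℕ).card = 2 := Finset.card_pair hst
  by_cases hK : IsBidirComplete 4 W
  · exfalso
    have hPS : D.P {s, t} ≤ 114 := by
      have := P_le (D := D) (hSQ.trans hQ) (a := 0) (t := 0) (by omega) (by omega)
      rw [hS2] at this
      omega
    have hg := hc.gap hr hQ hSQ h.crit ⟨s, by simp⟩ (Or.inl hK) ∅ (by simp)
    simp only [Finset.card_empty, hk] at hg
    have hPR : D.P ({s, t} ∪ W.verts) ≤ 77 := by omega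
    have inner : ∀ v p q, v ≠ p → v ≠ q → p ≠ q → W.verts.erase s = {v, p, q} →
        ¬ D.Dig v s → ¬ D.Dig v t → False := by
      intro v p q hvp hvq hpq he hvs hvt
      have hm : ∀ a, a ∈ W.verts.erase s ↔ a = v ∨ a = p ∨ a = q := by
        intro a; rw [he]; simp
      have hv1 := Finset.mem_erase.1 ((hm v).2 (by simp))
      have hp1 := Finset.mem_erase.1 ((hm p).2 (by simp))
      have hq1 := Finset.mem_erase.1 ((hm q).2 (by simp))
      have hv2 : v ≠ t := fun e => htW (e ▸ hv1.2)
      have hp2 : p ≠ t := fun e => htW (e ▸ hp1.2)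
      have hq2 : q ≠ t := fun e => htW (e ▸ hq1.2)
      let φ : ℕ → Fin 3 := fun a => if a = p then 1 else if a = q then 2 else 0
      have fp : φ p = 1 := by simp [φ]
      have fq : φ q = 2 := by simp [φ, hpq.symm]
      have fv : φ v = 0 := by simp [φ, hvp, hvq]
      have fs : φ s = 0 := by simp [φ, hp1.1.symm, hq1.1.symm]
      have ft : φ t = 0 := by simp [φ, hp2.symm, hq2.symm]
      have c1 : D.Col {s, v} φ := col_pair hv1.1.symm (fun e => hvs e.symm) φ
      have c2 : D.Col (insert t {s, v}) φ := by
        refine c1.ins (by simp [hst.symm, hv2.symm]) ?_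
        by_cases hd : D.Adj v t
        · right
          intro a ha hta
          simp only [Finset.mem_insert, Finset.mem_singleton] at ha
          rcases ha with rfl | rfl
          · exact absurd hta hnadj.2
          · exact absurd ⟨hd, hta⟩ hvt
        · left
          intro a ha hta
          simp only [Finset.mem_insert, Finset.mem_singleton] at ha
          rcases ha with rfl | rfl
          · exact absurd hta hnadj.1
          · exact absurd hta hd
      have c3 : D.Col (insert p (insert t {s, v})) φ := by
        refine c2.ins (by simp [hp2, hp1.1, hvp.symm]) (Or.inl ?_)
        intro a ha _
        simp only [Finset.mem_insert, Finset.mem_singleton] at ha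
        rcases ha with rfl | rfl | rfl
        · rw [ft, fp]; decide
        · rw [fs, fp]; decide
        · rw [fv, fp]; decide
      have c4 : D.Col (insert q (insert p (insert t {s, v}))) φ := by
        refine c3.ins (by simp [hq2, hq1.1, hvq.symm, hpq.symm]) (Or.inl ?_)
        intro a ha _
        simp only [Finset.mem_insert, Finset.mem_singleton] at ha
        rcases ha with rfl | rfl | rfl | rfl
        · rw [fp, fq]; decide
        · rw [ft, fq]; decide
        · rw [fs, fq]; decide
        · rw [fv, fq]; decide
      have hset : insert q (insert p (insert t {s, v})) = ({s, t} : Finset ℕ) ∪ W.verts := by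
        rw [← Finset.insert_erase hsW, he]
        ext a
        simp only [Finset.mem_insert, Finset.mem_singleton, Finset.mem_union]
        tauto
      rw [hset] at c4
      obtain ⟨ψ, hψ, hag⟩ := h.ext hQ hQne (Finset.union_subset hSQ hc.sub) ⟨s, by simp⟩ c4
        (hPR.trans (by norm_num))
      exact claim1 ψ hψ (by rw [hag s (by simp), hag t (by simp), fs, ft])
    obtain ⟨p, q, w, hpq, hpw, hqw, he⟩ := Finset.card_eq_three.1
      (show (W.verts.erase s).card = 3 by rw [Finset.card_erase_of_mem hsW, hK.1])
    have hm : ∀ a, a ∈ W.verts.erase s ↔ a = p ∨ a = q ∨ a = w := by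
      intro a; rw [he]; simp
    have hp1 := Finset.mem_erase.1 ((hm p).2 (by simp))
    have hq1 := Finset.mem_erase.1 ((hm q).2 (by simp))
    have hw1 := Finset.mem_erase.1 ((hm w).2 (by simp))
    have hdig : ∀ a b, a ∈ W.verts → b ∈ W.verts → a ≠ s → b ≠ s → a ≠ b → D.Dig a b :=
      fun a b ha hb has hbs hab => ⟨huu a b (hK.2 a ha b hb hab) has hbs,
        huu b a (hK.2 b hb a ha hab.symm) hbs has⟩
    have dpq := hdig p q hp1.2 hq1.2 hp1.1 hq1.1 hpq
    have dpw := hdig p w hp1.2 hw1.2 hp1.1 hw1.1 hpw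
    have dqw := hdig q w hq1.2 hw1.2 hq1.1 hw1.1 hqw
    have nd : ∀ e, e ≠ p → e ≠ q → e ≠ w → ¬ (D.Dig p e ∧ D.Dig q e) ∧ ¬ (D.Dig p e ∧ D.Dig w e) ∧
        ¬ (D.Dig q e ∧ D.Dig w e) := by
      intro e e1 e2 e3
      exact ⟨fun hh => h.no_diamond e3 hh.1.symm hh.2.symm dpq dpw dqw,
        fun hh => h.no_diamond e2 hh.1.symm hh.2.symm dpw dpq dqw.symm,
        fun hh => h.no_diamond e1 hh.1.symm hh.2.symm dqw dpq.symm dpw.symm⟩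
    have nds := nd s hp1.1.symm hq1.1.symm hw1.1.symm
    have ndt := nd t (fun e => htW (e ▸ hp1.2)) (fun e => htW (e ▸ hq1.2)) (fun e => htW (e ▸ hw1.2))
    have ip := inner p q w hpq hpw hqw he
    have iq := inner q p w hpq.symm hqw hpw (by rw [he]; exact Finset.insert_comm _ _ _)
    have iw := inner w p q hpw.symm hqw.symm hpq (by
      rw [he]; exact perm3 p q w)
    exact pigeon3 nds ndt ip iq iw
  · have hW17 : W.pw ≤ 17 := (h.small1 hc hQ hQne).resolve_left hK
    have harcs := hc.arcs hr ∅ (by simp)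
    rw [hk] at harcs
    simp only [Finset.card_empty] at harcs
    have hcard := Finset.card_union_add_card_inter {s, t} W.verts
    rw [Finset.inter_comm, hk, hS2] at hcard
    set R := ({s, t} : Finset ℕ) ∪ W.verts with hR
    have hRQ : R ⊆ Q := Finset.union_subset hSQ hc.sub
    have hyR : y ∉ R := fun e => hyQ (hRQ e)
    have huR : u ∉ insert y R := by
      rw [Finset.mem_insert]
      rintro (e | e)
      · exact hyu.ne e.symm
      · exact huQ (hRQ e)
    have hRV : insert y R ⊆ D.verts := Finset.insert_subset hyV (hRQ.trans hQ)
    have harc2 := arcs_insert (D := D) hyR {s, t} {s, t} Finset.subset_union_left Finset.subset_union_left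
      (by simp [hys.1, hyt.1]) (by simp [hys.2, hyt.2])
    rw [hS2] at harc2
    have hsubW : ∀ A, R ⊆ A → Subd (W.induce (W.verts.erase s)) (D.induce A) := by
      intro A hA
      rw [← hWd]
      have h1 := hc.TTsub hr hQ
      exact ⟨h1.1.trans (induce_subd hA).1, fun a b hab => (induce_subd hA).2 (h1.2 hab)⟩
    have hT2 : (W.induce (W.verts.erase s)).TT + 1 ≤ (D.induce (insert y R)).TT := by
      have hcl : (D.induce (insert y R)).Clq {y, s} := clq_pair
        ⟨⟨hys.1, by simp, by simp [hR]⟩, ⟨hys.2, by simp [hR], by simp⟩⟩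
      have := TT_add_clq (hsubW _ (Finset.subset_insert y R)) hcl (by
        rw [Finset.disjoint_left]
        intro a ha ha'
        have ha' := (Finset.mem_inter.1 ha').2
        rw [Finset.mem_erase] at ha'
        simp only [Finset.mem_insert, Finset.mem_singleton] at ha
        rcases ha with rfl | rfl
        · exact (hWQ _ ha'.2).2.1 rfl
        · exact ha'.1 rfl)
      rwa [Finset.card_pair hys.ne] at this
    have hTe := TT_erase W s
    have hcy : (insert y R).card = R.card + 1 := Finset.card_insert_of_notMem hyR
    have hPR : D.P (insert y R) ≤ 63 := by
      unfold P pw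
      unfold pw at hW17
      rw [induce_verts hRV, hcy]
      omega
    have hp := h.hp
    have hl3 := h.lem3 hRV (fun e => huR (e ▸ huV)) (by
      have := hc.crit.four_le
      omega)
    have hVR : insert u (insert y R) = D.verts := by
      apply Finset.eq_of_subset_of_card_le (Finset.insert_subset huV hRV)
      rw [Finset.card_insert_of_notMem huR]
      by_contra hlt
      have := hl3.2 (by omega)
      omega
    have harc3 := arcs_insert (D := D) huR (D.verts.filter (fun v => D.Adj u v))
      (D.verts.filter (fun v => D.Adj v u)) (by
        intro v hv
        rw [Finset.mem_filter, ← hVR, Finset.mem_insert] at hv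
        exact hv.1.resolve_left (fun e => D.adj_irrefl u (e ▸ hv.2))) (by
        intro v hv
        rw [Finset.mem_filter, ← hVR, Finset.mem_insert] at hv
        exact hv.1.resolve_left (fun e => D.adj_irrefl u (e ▸ hv.2)))
      (fun v hv => (Finset.mem_filter.1 hv).2) (fun v hv => (Finset.mem_filter.1 hv).2)
    have e1 : (D.verts.filter (fun v => D.Adj u v)).card = 3 := by
      unfold dout at hu; convert hu
    have e2 : (D.verts.filter (fun v => D.Adj v u)).card = D.din u := by
      rw [din_eq]
    rw [e1, e2] at harc3
    have hTD : (D.induce (insert y R)).TT ≤ D.TT := TT_mono (induce_subd' D _)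
    have hdin := h.crit.din_ge huV
    have hcV : D.verts.card = R.card + 2 := by
      rw [← hVR, Finset.card_insert_of_notMem huR, hcy]
    have hpP := P_verts D
    rw [← hVR] at hpP
    have hPV : D.pw ≤ 57 * (D.verts.card : ℤ) - 17 * (D.induce (insert u (insert y R))).arcs.card
        - 2 * D.TT := by
      rw [hVR]
      have : (D.induce D.verts).arcs.card ≤ D.arcs.card :=
        Finset.card_le_card (arcs_mono (induce_subd' D _))
      unfold pw
      omega
    unfold pw at hW17
    refine ⟨by omega, W, hWQ, huu, hus', hsu', by omega⟩

lemma MC.claimB (h : D.MC) {x y z : ℕ} (hy : D.din y = 3) (hx : D.dout x = 3) (hz : D.dout z = 3)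
    (hxy : D.Adj x y) (hzy : D.Adj z y) (hxz : x ≠ z) : False := by
  classical
  obtain ⟨w, hwx, hwz, hwy, hin⟩ := din3' hy hxy hzy hxz.symm
  have dyx : D.Dig y x := ⟨h.claimA' hz hy hzy hxy hxz, hxy⟩
  have dyz : D.Dig y z := ⟨h.claimA' hx hy hxy hzy hxz.symm, hzy⟩
  have dyw : D.Dig y w := ⟨h.claimA' hx hy hxy hwy hwx, hwy⟩
  have case2 : ∀ x z, x ≠ z → w ≠ x → w ≠ z → D.dout x = 3 →
      (∀ u, D.Adj u y → u = x ∨ u = z ∨ u = w) →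
      D.Dig y x → D.Dig y z → D.Dig x w → False := by
    intro x z hxz hwx hwz hx hin dyx dyz dxw
    have hzw : ¬ D.Dig z w := fun dzw => h.no_diamond hxz dyx.symm dxw dyw dyz dzw.symm
    obtain ⟨_, W, hWv, huu, _, _, hT⟩ := h.lemC (y := y) (s := z) (t := w) (u := x)
      (fun v hv => by have := hin v hv; tauto) dyz dyw dyx hx hwz.symm hxz hwx.symm hzw
    have hs : Subd (W.induce (W.verts.erase z)) D := by
      refine ⟨fun v hv => (hWv v (Finset.mem_inter.1 hv).1).1, ?_⟩
      rintro a b ⟨h1, h2, h3⟩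
      exact huu a b h1 (Finset.mem_erase.1 h2).1 (Finset.mem_erase.1 h3).1
    have h1 := TT_add_clq hs (clq_triple dyx.symm dxw dyw) (by
      rw [Finset.disjoint_left]
      intro a ha ha'
      have := hWv a (Finset.mem_inter.1 ha').1
      simp only [Finset.mem_insert, Finset.mem_singleton] at ha
      tauto)
    rw [Finset.card_eq_three.2 ⟨x, y, w, dyx.ne.symm, dxw.ne, dyw.ne, rfl⟩] at h1
    have h2 := TT_erase W z
    omega
  by_cases dxw : D.Dig x w
  · exact case2 x z hxz hwx hwz hx hin dyx dyz dxw
  by_cases dzw : D.Dig z w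
  · exact case2 z x hxz.symm hwz hwx hz (fun u hu => by have := hin u hu; tauto) dyz dyx dzw
  have hdx := (h.lemC (y := y) (s := z) (t := w) (u := x)
      (fun v hv => by have := hin v hv; tauto) dyz dyw dyx hx hwz.symm hxz hwx.symm dzw).1
  obtain ⟨_, W, hWv, huu, hus, hsu, hT⟩ := h.lemC (y := y) (s := x) (t := w) (u := z)
      (fun v hv => by have := hin v hv; tauto) dyx dyw dyz hz hwx.symm hxz.symm hwz.symm dxw
  have hxo : ∀ v, D.Adj x v → D.Adj v x := by
    intro v hv
    by_cases e : v = y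
    · rw [e]; exact dyx.1
    · exact h.claimA hx hy hxy hv e
  have hxi : ∀ v, D.Adj v x → D.Adj x v := by
    have hsub : D.verts.filter (fun v => D.Adj x v) ⊆ D.verts.filter (fun v => D.Adj v x) := by
      intro v hv
      rw [Finset.mem_filter] at hv ⊢
      exact ⟨hv.1, hxo v hv.2⟩
    have e1 : (D.verts.filter (fun v => D.Adj x v)).card = 3 := by unfold dout at hx; convert hx
    have e2 : (D.verts.filter (fun v => D.Adj v x)).card = 3 := by rw [din_eq] at hdx; convert hdx
    have := Finset.eq_of_subset_of_card_le hsub (by rw [e1, e2])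
    intro v hv
    have hm : v ∈ D.verts.filter (fun v => D.Adj v x) := Finset.mem_filter.2 ⟨(D.adj_mem hv).1, hv⟩
    rw [← this] at hm
    exact (Finset.mem_filter.1 hm).2
  have hWd : ∀ a, W.Adj a x → W.Adj x a → D.Dig x a ∨ D.Dig w a := by
    intro a h1 h2
    by_cases ha : D.Adj x a
    · exact Or.inl ⟨ha, hxo a ha⟩
    · have hb : ¬ D.Adj a x := fun e => ha (hxi a e)
      exact Or.inr ⟨(hsu a h2).resolve_left ha, (hus a h1).resolve_left hb⟩
  obtain ⟨P, hP, he⟩ := TT_exists W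
  have hcl : ∀ t ∈ P, x ∉ t → D.Clq t := by
    intro t ht hxt
    obtain ⟨h1, h2, h3⟩ := hP.1 t ht
    exact ⟨h1, fun v hv => (hWv v (h2 hv)).1, fun a ha b hb hab =>
      huu a b (h3 a ha b hb hab) (fun e => hxt (e ▸ ha)) (fun e => hxt (e ▸ hb))⟩
  by_cases hxP : ∃ s ∈ P, x ∈ s
  · obtain ⟨s, hs, hxs⟩ := hxP
    have hsW := hP.1 s hs
    have hother : ∀ t ∈ P.erase s, x ∉ t ∧ Disjoint s t := by
      intro t ht
      have hd := hP.2 hs (Finset.mem_of_mem_erase ht) (Finset.ne_of_mem_erase ht).symm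
      exact ⟨Finset.disjoint_left.1 hd hxs, hd⟩
    have hP0 : D.IsPacking (P.erase s) :=
      ⟨fun t ht => hcl t (Finset.mem_of_mem_erase ht) (hother t ht).1,
        fun a ha b hb hab => hP.2 (Finset.mem_of_mem_erase ha) (Finset.mem_of_mem_erase hb) hab⟩
    have hav : ∀ t ∈ P.erase s, ∀ v ∈ t, v ≠ y ∧ v ≠ z ∧ v ≠ w := fun t ht v hv =>
      (hWv v ((hP.1 t (Finset.mem_of_mem_erase ht)).2.1 hv)).2
    have hsv : ∀ v ∈ s, v ≠ y ∧ v ≠ z ∧ v ≠ w := fun v hv => (hWv v (hsW.2.1 hv)).2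
    obtain ⟨hP1, e1⟩ := packing_insert hP0 (clq_pair dyz) (fun t ht => by
      rw [Finset.disjoint_left]
      intro a ha ha'
      have := hav t ht a ha'
      simp only [Finset.mem_insert, Finset.mem_singleton] at ha
      tauto)
    rw [Finset.card_pair dyz.ne] at e1
    set P1 := insert ({y, z} : Finset ℕ) (P.erase s) with hP1def
    have hsum := Finset.add_sum_erase P (fun s => s.card - 1) hs
    have hdisj : ∀ c : Finset ℕ, c ⊆ insert w s → ∀ t ∈ P1, Disjoint c t := by
      intro c hcs t ht
      rw [Finset.disjoint_left]
      intro a ha ha'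
      have haw := Finset.mem_insert.1 (hcs ha)
      rcases Finset.mem_insert.1 ht with rfl | ht
      · simp only [Finset.mem_insert, Finset.mem_singleton] at ha'
        rcases haw with rfl | haw
        · rcases ha' with e | e
          · exact dyw.ne e.symm
          · exact hwz e
        · have := hsv a haw
          tauto
      · rcases haw with rfl | haw
        · exact (hav t ht a ha').2.2 rfl
        · exact Finset.disjoint_left.1 (hother t ht).2 haw ha'
    have one : ∀ c : Finset ℕ, c ⊆ insert w s → D.Clq c → c.card = s.card → False := by
      intro c hcs hc hcc
      obtain ⟨h1, h2⟩ := packing_insert hP1 hc (hdisj c hcs)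
      have := TT_ge h1
      rw [hcc] at h2
      omega
    have two : ∀ c c' : Finset ℕ, c ⊆ insert w s → c' ⊆ insert w s → D.Clq c → D.Clq c' →
        Disjoint c' c → c.card = 2 → c'.card = 2 → s.card = 3 → False := by
      intro c c' hcs hcs' hc hc' hd h2 h2' h3
      obtain ⟨h4, h5⟩ := packing_insert hP1 hc (hdisj c hcs)
      obtain ⟨h6, h7⟩ := packing_insert h4 hc' (fun t ht => by
        rcases Finset.mem_insert.1 ht with rfl | ht
        · exact hd
        · exact hdisj c' hcs' t ht)
      have := TT_ge h6
      rw [h2] at h5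
      rw [h2'] at h7
      rw [h3] at hsum
      omega
    have hWs : ∀ a ∈ s, a ≠ x → D.Dig x a ∨ D.Dig w a := fun a ha hax =>
      hWd a (hsW.2.2 a ha x hxs hax) (hsW.2.2 x hxs a ha hax.symm)
    rcases hsW.1 with hc2 | hc3
    · obtain ⟨v, hv, hvx⟩ := Finset.exists_mem_ne (show 1 < s.card by omega) x
      rcases hWs v hv hvx with hd | hd
      · refine one {x, v} ?_ (clq_pair hd) (by rw [Finset.card_pair hd.ne, hc2])
        intro a ha
        simp only [Finset.mem_insert, Finset.mem_singleton] at ha ⊢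
        rcases ha with rfl | rfl <;> tauto
      · refine one {w, v} ?_ (clq_pair hd) (by rw [Finset.card_pair hd.ne, hc2])
        intro a ha
        simp only [Finset.mem_insert, Finset.mem_singleton] at ha ⊢
        rcases ha with rfl | rfl <;> tauto
    · have hce : (s.erase x).card = 2 := by rw [Finset.card_erase_of_mem hxs, hc3]
      obtain ⟨v1, v2, h12, hse⟩ := Finset.card_eq_two.1 hce
      have hv1 : v1 ∈ s.erase x := by rw [hse]; simp
      have hv2 : v2 ∈ s.erase x := by rw [hse]; simp
      rw [Finset.mem_erase] at hv1 hv2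
      have d12 : D.Dig v1 v2 := ⟨huu _ _ (hsW.2.2 v1 hv1.2 v2 hv2.2 h12) hv1.1 hv2.1,
        huu _ _ (hsW.2.2 v2 hv2.2 v1 hv1.2 h12.symm) hv2.1 hv1.1⟩
      have hw1 := (hsv v1 hv1.2).2.2
      have hw2 := (hsv v2 hv2.2).2.2
      have sub3 : ∀ a b c, (a = x ∨ a = w ∨ a = v1 ∨ a = v2) → (b = x ∨ b = w ∨ b = v1 ∨ b = v2) →
          (c = x ∨ c = w ∨ c = v1 ∨ c = v2) → ({a, b, c} : Finset ℕ) ⊆ insert w s := by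
        have one : ∀ a, (a = x ∨ a = w ∨ a = v1 ∨ a = v2) → a ∈ insert w s := by
          rintro a (rfl | rfl | rfl | rfl)
          · exact Finset.mem_insert_of_mem hxs
          · exact Finset.mem_insert_self _ _
          · exact Finset.mem_insert_of_mem hv1.2
          · exact Finset.mem_insert_of_mem hv2.2
        intro a b c ha hb hc v hv
        simp only [Finset.mem_insert, Finset.mem_singleton] at hv
        rcases hv with rfl | rfl | rfl
        · exact one _ ha
        · exact one _ hb
        · exact one _ hc
      have sub2 : ∀ a b, (a = x ∨ a = w ∨ a = v1 ∨ a = v2) → (b = x ∨ b = w ∨ b = v1 ∨ b = v2) →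
          ({a, b} : Finset ℕ) ⊆ insert w s := by
        intro a b ha hb
        have := sub3 a b b ha hb hb
        simpa using this
      rcases hWs v1 hv1.2 hv1.1 with d1 | d1 <;> rcases hWs v2 hv2.2 hv2.1 with d2 | d2
      · exact one {x, v1, v2} (sub3 _ _ _ (by simp) (by simp) (by simp)) (clq_triple d1 d2 d12)
          (by rw [hc3]; exact Finset.card_eq_three.2 ⟨_, _, _, d1.ne, d2.ne, d12.ne, rfl⟩)
      · refine two {x, v1} {w, v2} (sub2 _ _ (by simp) (by simp)) (sub2 _ _ (by simp) (by simp))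
          (clq_pair d1) (clq_pair d2) ?_ (Finset.card_pair d1.ne) (Finset.card_pair d2.ne) hc3
        simp [hwx, hw1.symm, hv2.1, h12.symm, hwx.symm, hw1, h12, hv2.1.symm]
      · refine two {w, v1} {x, v2} (sub2 _ _ (by simp) (by simp)) (sub2 _ _ (by simp) (by simp))
          (clq_pair d1) (clq_pair d2) ?_ (Finset.card_pair d1.ne) (Finset.card_pair d2.ne) hc3
        simp [hwx, hw2.symm, hv1.1, h12.symm, hwx.symm, hw2, h12, hv1.1.symm]
      · exact one {w, v1, v2} (sub3 _ _ _ (by simp) (by simp) (by simp)) (clq_triple d1 d2 d12)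
          (by rw [hc3]; exact Finset.card_eq_three.2 ⟨_, _, _, d1.ne, d2.ne, d12.ne, rfl⟩)
  · push Not at hxP
    have hP0 : D.IsPacking P := ⟨fun t ht => hcl t ht (hxP t ht), hP.2⟩
    obtain ⟨hP1, e1⟩ := packing_insert hP0 (clq_pair dyz) (fun t ht => by
      rw [Finset.disjoint_left]
      intro a ha ha'
      have := (hWv a ((hP.1 t ht).2.1 ha')).2
      simp only [Finset.mem_insert, Finset.mem_singleton] at ha
      tauto)
    rw [Finset.card_pair dyz.ne] at e1
    have := TT_ge hP1
    omega

lemma MC.claimB' (h : D.MC) {x y z : ℕ} (hy : D.dout y = 3) (hx : D.din x = 3) (hz : D.din z = 3)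
    (hxy : D.Adj y x) (hzy : D.Adj y z) (hxz : x ≠ z) : False :=
  h.rev.claimB (x := x) (y := y) (z := z) hy hx hz hxy hzy hxz
end
end Dgr

namespace Dgr

/-- amount (scaled by 4) sent by a half-vertex of degree at least four -/
def tau (M : Finset ℕ) (v : ℕ) : ℤ := if v ∈ M then 12 else 11

/-- charge (scaled by 4) received by the out-half of `u` along the arc `u → v` -/
noncomputable def flow (D : Dgr) (M : Finset ℕ) (u v : ℕ) : ℤ :=
  if D.dout u = 3 then (if D.din v = 3 then 0 else tau M v)
  else (if D.din v = 3 then - tau M u else 0)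

lemma flow_rev (D : Dgr) (M : Finset ℕ) (u v : ℕ) : D.rev.flow M v u = - D.flow M u v := by
  unfold flow
  rw [dout_rev, din_rev]
  split_ifs <;> simp

lemma tau_ge (M : Finset ℕ) (v : ℕ) : 11 ≤ tau M v := by
  unfold tau; split_ifs <;> norm_num

open Classical in
lemma MC.half {D : Dgr} (h : D.MC) {M : Finset ℕ} (hM : ∀ u v, D.Dig u v → u ∈ M ∨ v ∈ M)
    {u : ℕ} (hu : u ∈ D.verts) :
    0 ≤ 4 * (17 * (D.dout u : ℤ) - 57 + (if u ∈ M then 1 else 0)) +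
      ∑ v ∈ D.verts.filter (fun v => D.Adj u v), D.flow M u v := by
  have hge := h.crit.dout_ge hu
  have hc : (D.verts.filter (fun v => D.Adj u v)).card = D.dout u := rfl
  by_cases h3 : D.dout u = 3
  · by_cases hy : ∃ y, D.Adj u y ∧ D.din y = 3
    · obtain ⟨y, huy, hy⟩ := hy
      obtain ⟨a, b, hay, hby, hab, hua, hub, hall⟩ := dout3 h3 huy
      have hN : D.verts.filter (fun v => D.Adj u v) = {y, a, b} := by
        ext v
        simp only [Finset.mem_filter, Finset.mem_insert, Finset.mem_singleton]
        constructor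
        · exact fun hv => hall v hv.2
        · rintro (rfl | rfl | rfl)
          · exact ⟨(D.adj_mem huy).2, huy⟩
          · exact ⟨(D.adj_mem hua).2, hua⟩
          · exact ⟨(D.adj_mem hub).2, hub⟩
      have ha3 : D.din a ≠ 3 := fun e => h.claimB' h3 hy e huy hua hay.symm
      have hb3 : D.din b ≠ 3 := fun e => h.claimB' h3 hy e huy hub hby.symm
      have hau := h.claimA h3 hy huy hua hay
      have hbu := h.claimA h3 hy huy hub hby
      have hMa := hM u a ⟨hua, hau⟩
      have hMb := hM u b ⟨hub, hbu⟩
      rw [hN, Finset.sum_insert (by simp [hay.symm, hby.symm]), Finset.sum_insert (by simp [hab]),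
        Finset.sum_singleton]
      unfold flow
      simp only [h3, hy, ha3, hb3, if_true, if_false]
      have ta := tau_ge M a
      have tb := tau_ge M b
      by_cases huM : u ∈ M
      · simp only [huM, if_true]; push_cast; linarith
      · have ea : tau M a = 12 := by unfold tau; rw [if_pos (hMa.resolve_left huM)]
        have eb : tau M b = 12 := by unfold tau; rw [if_pos (hMb.resolve_left huM)]
        simp only [huM, if_false]; rw [ea, eb]; norm_num
    · push Not at hy
      have : (D.verts.filter (fun v => D.Adj u v)).card • (11 : ℤ) ≤
          ∑ v ∈ D.verts.filter (fun v => D.Adj u v), D.flow M u v := by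
        apply Finset.card_nsmul_le_sum
        intro v hv
        have := hy v (Finset.mem_filter.1 hv).2
        unfold flow
        rw [if_pos h3, if_neg this]
        exact tau_ge M v
      rw [hc, h3] at this
      rw [h3]
      split_ifs <;> simp at this ⊢ <;> linarith
  · have : (D.verts.filter (fun v => D.Adj u v)).card • (- tau M u) ≤
          ∑ v ∈ D.verts.filter (fun v => D.Adj u v), D.flow M u v := by
        apply Finset.card_nsmul_le_sum
        intro v hv
        unfold flow
        rw [if_neg h3]
        have := tau_ge M u
        split_ifs
        · exact le_refl _
        · linarith
    rw [hc] at this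
    have h4 : (4 : ℤ) ≤ D.dout u := by exact_mod_cast (by omega : 4 ≤ D.dout u)
    unfold tau at this
    split_ifs at this ⊢ <;> simp at this ⊢ <;> linarith

open Classical in
lemma sum_dout (D : Dgr) : ∑ u ∈ D.verts, (D.dout u : ℤ) = D.arcs.card := by
  unfold dout arcs
  simp only [Finset.card_filter, Finset.sum_product]
  push_cast
  rfl

lemma sum_din (D : Dgr) : ∑ u ∈ D.verts, (D.din u : ℤ) = D.arcs.card := by
  rw [← arcs_rev]; exact sum_dout D.rev

open Classical in
lemma MC.false {D : Dgr} (h : D.MC) : False := by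
  obtain ⟨P, hP, hT⟩ := TT_exists D
  set M := P.biUnion id with hMdef
  have hMd : ∀ u v, D.Dig u v → u ∈ M ∨ v ∈ M := by
    intro u v huv
    by_contra hcon
    push Not at hcon
    have h1 := packing_insert hP (clq_pair huv) (by
      intro t ht
      rw [Finset.disjoint_left]
      intro a ha hat
      have haM : a ∈ M := Finset.mem_biUnion.2 ⟨t, ht, hat⟩
      simp only [Finset.mem_insert, Finset.mem_singleton] at ha
      rcases ha with rfl | rfl
      · exact hcon.1 haM
      · exact hcon.2 haM)
    have h2 := TT_ge h1.1
    rw [h1.2, Finset.card_pair huv.ne] at h2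
    omega
  have hMV : M ⊆ D.verts := by
    intro a ha
    obtain ⟨t, ht, hat⟩ := Finset.mem_biUnion.1 ha
    exact (hP.1 t ht).2.1 hat
  have hMc : M.card ≤ 2 * D.TT := by
    rw [hT, Finset.mul_sum]
    refine Finset.card_biUnion_le.trans (Finset.sum_le_sum ?_)
    intro s hs
    have := (hP.1 s hs).1
    simp only [id]
    omega
  have hMs : ∑ u ∈ D.verts, (if u ∈ M then (1 : ℤ) else 0) = M.card := by
    rw [← Finset.sum_filter, Finset.filter_mem_eq_inter, Finset.inter_eq_right.2 hMV]
    simp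
  have hplus := Finset.sum_nonneg (fun u hu => h.half hMd (u := u) hu)
  have hminus := Finset.sum_nonneg (fun u hu => h.rev.half (M := M)
    (fun a b hab => hMd a b ⟨hab.2, hab.1⟩) (u := u) hu)
  have hcancel : ∑ u ∈ D.verts, ∑ v ∈ D.rev.verts.filter (fun v => D.rev.Adj u v), D.rev.flow M u v
      = - ∑ u ∈ D.verts, ∑ v ∈ D.verts.filter (fun v => D.Adj u v), D.flow M u v := by
    simp only [Finset.sum_filter]
    rw [← Finset.sum_neg_distrib]
    change ∑ u ∈ D.verts, ∑ v ∈ D.verts, _ = _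
    rw [Finset.sum_comm]
    refine Finset.sum_congr rfl (fun u _ => ?_)
    rw [← Finset.sum_neg_distrib]
    refine Finset.sum_congr rfl (fun v _ => ?_)
    rw [flow_rev]
    change (if D.Adj u v then _ else _) = _
    split_ifs <;> simp
  have hV : D.rev.verts = D.verts := rfl
  have sd := sum_dout D
  have si := sum_din D
  rw [Finset.sum_add_distrib, ← Finset.mul_sum, Finset.sum_add_distrib, Finset.sum_sub_distrib,
    ← Finset.mul_sum, hMs, sd, Finset.sum_const, nsmul_eq_mul] at hplus
  simp only [dout_rev] at hminus
  rw [Finset.sum_add_distrib, ← Finset.mul_sum, Finset.sum_add_distrib, Finset.sum_sub_distrib,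
    ← Finset.mul_sum] at hminus
  rw [hV] at hminus
  rw [hV] at hcancel
  rw [hMs, si, Finset.sum_const, nsmul_eq_mul, hcancel] at hminus
  have hp := h.hp
  unfold pw at hp
  have hMc' : (M.card : ℤ) ≤ 2 * D.TT := by exact_mod_cast hMc
  linarith

theorem Crit.pw_le : ∀ (n : ℕ) (D : Dgr), D.verts.card = n → D.Crit →
    IsBidirComplete 4 D ∨ D.pw ≤ 17 := by
  intro n
  induction n using Nat.strong_induction_on with
  | _ n ih =>
    intro D hn hD
    by_contra hcon
    push Not at hcon
    exact MC.false (D := D) ⟨hD, hcon.1, by have := hcon.2; omega,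
      fun W hW hlt => ih _ (hn ▸ hlt) W rfl hW⟩

lemma Oriented.TT_zero {D : Dgr} (hor : D.Oriented) : D.TT = 0 := by
  obtain ⟨P, hP, hT⟩ := TT_exists D
  rw [hT]
  apply Finset.sum_eq_zero
  intro s hs
  exfalso
  obtain ⟨h1, _, h2⟩ := hP.1 s hs
  obtain ⟨a, ha, b, hb, hab⟩ := Finset.one_lt_card.1 (show 1 < s.card by omega)
  exact hor (h2 a ha b hb hab) (h2 b hb a ha hab.symm)

end Dgr

/-- every 4-dicritical oriented graph on `n` vertices has at least
`(10/3 + 1/51)n − 1` arcs. -/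
theorem stmt_16 (D : Dgr) (hor : D.Oriented) (hD : Dgr.Dicritical 4 D) :
    ((10 : ℝ) / 3 + 1 / 51) * (D.nV : ℝ) - 1 ≤ (D.nA : ℝ) := by
  have hc : D.Crit := Dgr.Dicritical.crit hD
  have hT := hor.TT_zero
  rcases Crit.pw_le _ D rfl hc with hK | hp
  · exfalso
    obtain ⟨a, ha, b, hb, hab⟩ := Finset.one_lt_card.1 (show 1 < D.verts.card by rw [hK.1]; norm_num)
    exact hor (hK.2 a ha b hb hab) (hK.2 b hb a ha hab.symm)
  · rw [nA_eq]
    unfold nV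
    unfold pw at hp
    rw [hT] at hp
    have hp' : (57 : ℝ) * D.verts.card - 17 * D.arcs.card - 2 * 0 ≤ 17 := by exact_mod_cast hp
    linarith
end

section
/- For every integer k ≥ 3 and every n0, there exists a k-dicritical oriented graph on n ≥ n0 vertices with at most (2k − 7/2)n arcs. -/
open Dgr

namespace Dcr

def AcyR {V : Type} (R : V → V → Prop) : Prop := ∀ v, ¬ Relation.TransGen R v v

theorem AcyR.mono {V : Type} {R S : V → V → Prop} (h : AcyR S) (hRS : ∀ u v, R u v → S u v) :
    AcyR R := fun v hv => h v (Relation.TransGen.mono hRS _ _ hv)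

theorem acy_rank {V : Type} {R : V → V → Prop} (f : V → ℕ) (h : ∀ u v, R u v → f u ≤ f v)
    (h2 : AcyR (fun u v => R u v ∧ f u = f v)) : AcyR R := by
  have key : ∀ u v, Relation.TransGen R u v → f u ≤ f v ∧
      (f u = f v → Relation.TransGen (fun u v => R u v ∧ f u = f v) u v) := by
    intro u v huv
    induction huv with
    | single h' => exact ⟨h _ _ h', fun e => .single ⟨h', e⟩⟩
    | tail h1 h' ih =>
      have := h _ _ h'
      refine ⟨ih.1.trans this, fun e => ?_⟩
      have e1 := ih.1
      exact .tail (ih.2 (by omega)) ⟨h', by omega⟩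
  intro v hv
  exact h2 v ((key v v hv).2 rfl)

def Col {V : Type} (q : ℕ) (R : V → V → Prop) : Prop :=
  ∃ φ : V → Fin q, AcyR (fun u v => R u v ∧ φ u = φ v)

structure Crit {V : Type} (q : ℕ) (R : V → V → Prop) : Prop where
  ne : Nonempty V
  ori : ∀ u v, R u v → ¬ R v u
  ncol : ¬ Col q R
  del : ∀ e f, R e f → Col q (fun u v => R u v ∧ ¬(u = e ∧ v = f))
  inc : ∀ v, ∃ u, R u v ∨ R v u

theorem Crit.one {W : Type} {q : ℕ} {R : W → W → Prop} (H : Crit q R) (h : W) (c : Fin (q+1)) :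
    ∃ ψ : W → Fin (q+1), AcyR (fun u v => R u v ∧ ψ u = ψ v) ∧ ψ h = c ∧ ∀ w, ψ w = c → w = h := by
  classical
  obtain ⟨φ, hφ⟩ : ∃ φ : W → Fin q, AcyR (fun u v => (R u v ∧ u ≠ h ∧ v ≠ h) ∧ φ u = φ v) := by
    obtain ⟨u, hu | hu⟩ := H.inc h
    · obtain ⟨φ, hφ⟩ := H.del _ _ hu
      exact ⟨φ, hφ.mono (fun u v => by tauto)⟩
    · obtain ⟨φ, hφ⟩ := H.del _ _ hu
      exact ⟨φ, hφ.mono (fun u v => by tauto)⟩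
  refine ⟨fun w => if w = h then c else c.succAbove (φ w), hφ.mono ?_, by simp, ?_⟩
  · rintro u v ⟨huv, e⟩
    by_cases hu : u = h <;> by_cases hv : v = h
    · subst hu; subst hv; exact absurd huv (H.ori _ _ huv)
    · simp [hu, hv] at e
    · simp [hu, hv] at e
    · simp [hu, hv] at e; exact ⟨⟨huv, hu, hv⟩, e⟩
  · intro w hw
    by_contra hne
    simp [hne] at hw

theorem Crit.delc {W : Type} {q : ℕ} {R : W → W → Prop} (H : Crit q R) (e f : W) (hef : R e f)
    (c : Fin (q+1)) : ∃ ψ : W → Fin (q+1),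
      AcyR (fun u v => (R u v ∧ ¬(u = e ∧ v = f)) ∧ ψ u = ψ v) ∧ ∀ w, ψ w ≠ c := by
  obtain ⟨φ, hφ⟩ := H.del _ _ hef
  refine ⟨fun w => c.succAbove (φ w), hφ.mono ?_, by simp⟩
  rintro u v ⟨h, e⟩
  exact ⟨h, Fin.succAbove_right_injective e⟩

/-- a colouring with `q+1` colours of a critical graph uses every colour -/
theorem Crit.surj {W : Type} {q : ℕ} {R : W → W → Prop} (H : Crit q R) (ψ : W → Fin (q+1))
    (hψ : AcyR (fun u v => R u v ∧ ψ u = ψ v)) (c : Fin (q+1)) : ∃ w, ψ w = c := by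
  by_contra hn
  push Not at hn
  have : ∀ w, ∃ z, c.succAbove z = ψ w := fun w => Fin.exists_succAbove_eq (hn w)
  choose φ hφ using this
  refine H.ncol ⟨φ, hψ.mono ?_⟩
  rintro u v ⟨h, e⟩
  exact ⟨h, by rw [← hφ, ← hφ, e]⟩

/-- undirected criticality of the base graph with arcs indexed by `A` -/
structure BCrit {V A : Type} (q : ℕ) (s t : A → V) : Prop where
  loop : ∀ a, s a ≠ t a
  two : ∀ a b, s a = t b → t a ≠ s b
  inj : ∀ a b, s a = s b → t a = t b → a = b
  ncol : ∀ φ : V → Fin q, ∃ a, φ (s a) = φ (t a)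
  del : ∀ a, ∃ φ : V → Fin q, ∀ b, b ≠ a → φ (s b) ≠ φ (t b)
  inc : ∀ v, ∃ a, s a = v ∨ t a = v

def Big {V A W : Type} (s t : A → V) (R : W → W → Prop) : V ⊕ (A × W) → V ⊕ (A × W) → Prop
  | .inl u, .inl v => ∃ a, s a = u ∧ t a = v
  | .inl u, .inr p => t p.1 = u
  | .inr p, .inl u => s p.1 = u
  | .inr p, .inr r => p.1 = r.1 ∧ R p.2 r.2

theorem acy_big {V A W C : Type} (D : V ⊕ (A × W) → V ⊕ (A × W) → Prop)
    (c : V ⊕ (A × W) → C) (ρ : V ⊕ (A × W) → ℕ)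
    (h1 : ∀ u v, D u v → c u = c v → ρ u < ρ v ∨
      (ρ u = ρ v ∧ ∃ a w z, u = .inr (a, w) ∧ v = .inr (a, z)))
    (h2 : ∀ a, AcyR (fun w z => D (.inr (a, w)) (.inr (a, z)) ∧ c (.inr (a, w)) = c (.inr (a, z)))) :
    AcyR (fun u v => D u v ∧ c u = c v) := by
  apply acy_rank ρ
  · rintro u v ⟨h, e⟩
    rcases h1 u v h e with h | h
    · exact h.le
    · exact h.1.le
  · have key : ∀ u v, Relation.TransGen (fun u v => (D u v ∧ c u = c v) ∧ ρ u = ρ v) u v →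
        ∃ a w z, u = .inr (a, w) ∧ v = .inr (a, z) ∧ Relation.TransGen (fun w z =>
          D (.inr (a, w)) (.inr (a, z)) ∧ c (.inr (a, w)) = c (.inr (a, z))) w z := by
      have step : ∀ u v, (D u v ∧ c u = c v) ∧ ρ u = ρ v →
          ∃ a w z, u = .inr (a, w) ∧ v = .inr (a, z) := by
        rintro u v ⟨⟨h, e⟩, r⟩
        rcases h1 u v h e with h | h
        · omega
        · exact h.2
      intro u v huv
      induction huv with
      | single h' =>
        obtain ⟨a, w, z, rfl, rfl⟩ := step _ _ h'
        exact ⟨a, w, z, rfl, rfl, .single h'.1⟩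
      | tail _ h' ih =>
        obtain ⟨a, w, z, rfl, rfl⟩ := step _ _ h'
        obtain ⟨b, x, y, rfl, e2, e3⟩ := ih
        simp only [Sum.inr.injEq, Prod.mk.injEq] at e2
        obtain ⟨rfl, rfl⟩ := e2
        exact ⟨a, x, z, rfl, rfl, .tail e3 h'.1⟩
    intro v hv
    obtain ⟨a, w, z, rfl, e, h⟩ := key v v hv
    simp only [Sum.inr.injEq, Prod.mk.injEq, true_and] at e
    subst e
    exact h2 a w h

theorem big_crit {V A W : Type} [Nonempty V] {q : ℕ} {s t : A → V} {R : W → W → Prop}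
    (B : BCrit (q+1) s t) (H : Crit q R) : Crit (q+1) (Big s t R) := by
  classical
  refine ⟨inferInstance, ?_, ?_, ?_, ?_⟩
  · rintro (u | ⟨a, w⟩) (v | ⟨b, z⟩) h h'
    · obtain ⟨a, rfl, rfl⟩ := h
      obtain ⟨b, h1, h2⟩ := h'
      exact B.two a b h2.symm h1.symm
    · simp only [Big] at h h'
      exact B.loop b (h'.trans h.symm)
    · simp only [Big] at h h'
      exact B.loop a (h.trans h'.symm)
    · exact H.ori _ _ h.2 h'.2
  · rintro ⟨φ, hφ⟩
    obtain ⟨a, ha⟩ := B.ncol (fun v => φ (.inl v))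
    obtain ⟨w, hw⟩ := H.surj (fun w => φ (.inr (a, w))) (by
      intro w hw
      refine hφ (.inr (a, w)) (Relation.TransGen.lift (fun w => Sum.inr (a, w)) ?_ _ _ hw)
      rintro x y ⟨h, e⟩
      exact ⟨⟨rfl, h⟩, e⟩) (φ (.inl (s a)))
    refine hφ (.inl (s a)) ?_
    refine .tail (b := .inr (a, w)) (.tail (b := .inl (t a)) (.single ?_) ?_) ?_
    · exact ⟨⟨a, rfl, rfl⟩, ha⟩
    · exact ⟨rfl, by rw [hw, ha]⟩
    · exact ⟨rfl, hw⟩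
  · -- deletions
    obtain ⟨h0⟩ := H.ne
    obtain ⟨ψ0, hψ0, -, -⟩ := H.one h0 0
    have main : ∀ (e f : V ⊕ (A × W)) (a0 : A) (φ : V → Fin (q+1)) (ψ : W → Fin (q+1)) (p : V)
        (r : ℕ), (∀ b, b ≠ a0 → φ (s b) ≠ φ (t b)) →
        AcyR (fun w z => (R w z ∧ ¬ (Sum.inr (a0, w) = e ∧ Sum.inr (a0, z) = f)) ∧ ψ w = ψ z) →
        ((Sum.inl (s a0) = e ∧ Sum.inl (t a0) = f) ∨ (p = s a0)) →
        (∀ w, ψ w = φ (t a0) → ¬ (Sum.inl (t a0) = e ∧ Sum.inr (a0, w) = f) →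
          (if t a0 = p then 4 else 6) < r) →
        (∀ w, ψ w = φ (s a0) → ¬ (Sum.inr (a0, w) = e ∧ Sum.inl (s a0) = f) →
          r < (if s a0 = p then 4 else 6)) →
        Col (q+1) (fun u v => Big s t R u v ∧ ¬(u = e ∧ v = f)) := by
      intro e f a0 φ ψ p r hφ hψ hb ht hs
      refine ⟨Sum.elim φ (fun x => if x.1 = a0 then ψ x.2 else ψ0 x.2), ?_⟩
      refine acy_big _ _ (Sum.elim (fun v => if v = p then 4 else 6)
        (fun x => if x.1 = a0 then r else if ψ0 x.2 = φ (s x.1) then 0 else 10)) ?_ ?_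
      · rintro (u | ⟨a, w⟩) (v | ⟨b, z⟩) ⟨h, hn⟩ hc
        · left
          obtain ⟨a, rfl, rfl⟩ := h
          simp only [Sum.elim_inl] at hc ⊢
          have : a = a0 := by
            by_contra hne
            exact hφ a hne hc
          subst this
          rcases hb with hb | hb
          · exact absurd hb hn
          · subst hb
            simp [(B.loop a).symm]
        · left
          simp only [Big] at h
          subst h
          by_cases hba : b = a0
          · subst hba
            simp only [Sum.elim_inl, Sum.elim_inr, if_true] at hc ⊢
            exact ht z hc.symm hn
          · simp only [Sum.elim_inl, Sum.elim_inr, hba, if_false] at hc ⊢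
            have := hφ b hba
            rw [← hc, if_neg (Ne.symm this)]
            split_ifs <;> omega
        · left
          simp only [Big] at h
          subst h
          by_cases hba : a = a0
          · subst hba
            simp only [Sum.elim_inl, Sum.elim_inr, if_true] at hc ⊢
            exact hs w hc hn
          · simp only [Sum.elim_inl, Sum.elim_inr, hba, if_false] at hc ⊢
            rw [if_pos hc]
            split_ifs <;> omega
        · right
          obtain ⟨h, -⟩ := h
          simp only at h
          subst h
          refine ⟨?_, a, w, z, rfl, rfl⟩
          by_cases hba : a = a0
          · simp [hba]
          · simp only [Sum.elim_inr, hba, if_false] at hc ⊢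
            rw [hc]
      · intro a
        by_cases hba : a = a0
        · subst hba
          refine hψ.mono ?_
          rintro w z ⟨⟨h, hn⟩, hc⟩
          simp only [Sum.elim_inr, if_true] at hc
          exact ⟨⟨h.2, hn⟩, hc⟩
        · refine hψ0.mono ?_
          rintro w z ⟨⟨h, hn⟩, hc⟩
          simp only [Sum.elim_inr, hba, if_false] at hc
          exact ⟨h.2, hc⟩
    have heq : ∀ a, ∃ φ : V → Fin (q+1), (∀ b, b ≠ a → φ (s b) ≠ φ (t b)) ∧ φ (s a) = φ (t a) := by
      intro a
      obtain ⟨φ, hφ⟩ := B.del a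
      refine ⟨φ, hφ, ?_⟩
      obtain ⟨b, hb⟩ := B.ncol φ
      by_cases h : b = a
      · rw [← h, hb]
      · exact absurd hb (hφ b h)
    rintro (u | ⟨a, w⟩) (v | ⟨b, z⟩) h
    · obtain ⟨a, rfl, rfl⟩ := h
      obtain ⟨φ, hφ, hφa⟩ := heq a
      refine main _ _ a φ ψ0 (t a) 5 hφ (hψ0.mono (by tauto)) (Or.inl ⟨rfl, rfl⟩) ?_ ?_
      · simp
      · simp [B.loop a]
    · simp only [Big] at h
      subst h
      obtain ⟨φ, hφ, hφa⟩ := heq b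
      obtain ⟨ψ, hψ, -, hu⟩ := H.one z (φ (t b))
      refine main _ _ b φ ψ (s b) 3 hφ (hψ.mono (by tauto)) (Or.inr rfl) ?_ ?_
      · intro w hw hn
        exact absurd ⟨rfl, by rw [hu w hw]⟩ hn
      · simp
    · simp only [Big] at h
      subst h
      obtain ⟨φ, hφ, hφa⟩ := heq a
      obtain ⟨ψ, hψ, -, hu⟩ := H.one w (φ (s a))
      refine main _ _ a φ ψ (s a) 7 hφ (hψ.mono (by tauto)) (Or.inr rfl) ?_ ?_
      · intros
        split_ifs <;> omega
      · intro z hz hn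
        exact absurd ⟨by rw [hu z hz], rfl⟩ hn
    · obtain ⟨h, h'⟩ := h
      simp only at h h'
      subst h
      obtain ⟨φ, hφ, hφa⟩ := heq a
      obtain ⟨ψ, hψ, hu⟩ := H.delc w z h' (φ (s a))
      refine main _ _ a φ ψ (s a) 7 hφ (hψ.mono ?_) (Or.inr rfl) ?_ ?_
      · rintro x y ⟨⟨h1, h2⟩, h3⟩
        refine ⟨⟨h1, fun h4 => h2 ?_⟩, h3⟩
        rw [h4.1, h4.2]
        exact ⟨rfl, rfl⟩
      · intros
        split_ifs <;> omega
      · intro z hz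
        exact absurd hz (hu z)
  · rintro (v | ⟨a, w⟩)
    · obtain ⟨a, h | h⟩ := B.inc v
      · exact ⟨.inl (t a), Or.inr ⟨a, h, rfl⟩⟩
      · exact ⟨.inl (s a), Or.inl ⟨a, rfl, h⟩⟩
    · exact ⟨.inl (t a), Or.inl rfl⟩

noncomputable def arcs {V : Type} (R : V → V → Prop) : ℕ := Nat.card {p : V × V // R p.1 p.2}

theorem big_arcs {V A W : Type} [Finite V] [Finite A] [Finite W] (s t : A → V) (R : W → W → Prop) :
    arcs (Big s t R) ≤ Nat.card A * (1 + arcs R + 2 * Nat.card W) := by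
  let F : (A ⊕ (A × {p : W × W // R p.1 p.2})) ⊕ ((A × W) ⊕ (A × W)) →
      {p : (V ⊕ (A × W)) × (V ⊕ (A × W)) // Big s t R p.1 p.2} := fun x => match x with
    | .inl (.inl a) => ⟨(.inl (s a), .inl (t a)), ⟨a, rfl, rfl⟩⟩
    | .inl (.inr (a, p)) => ⟨(.inr (a, p.1.1), .inr (a, p.1.2)), ⟨rfl, p.2⟩⟩
    | .inr (.inl (a, w)) => ⟨(.inl (t a), .inr (a, w)), rfl⟩
    | .inr (.inr (a, w)) => ⟨(.inr (a, w), .inl (s a)), rfl⟩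
  have hF : Function.Surjective F := by
    rintro ⟨⟨u | ⟨a, w⟩, v | ⟨b, z⟩⟩, h⟩
    · obtain ⟨a, rfl, rfl⟩ := h
      exact ⟨.inl (.inl a), rfl⟩
    · simp only [Big] at h
      subst h
      exact ⟨.inr (.inl (b, z)), rfl⟩
    · simp only [Big] at h
      subst h
      exact ⟨.inr (.inr (a, w)), rfl⟩
    · obtain ⟨h, h'⟩ := h
      simp only at h h'
      subst h
      exact ⟨.inl (.inr (a, ⟨(w, z), h'⟩)), rfl⟩
  have := Nat.card_le_card_of_surjective F hF
  simp only [Nat.card_sum, Nat.card_prod] at this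
  unfold arcs
  nlinarith

/-- directed triangle -/
theorem tri_crit : Crit 1 (fun u v : Fin 3 => v = u + 1) := by
  refine ⟨inferInstance, by decide, ?_, ?_, fun v => ⟨v + 1, Or.inr rfl⟩⟩
  · rintro ⟨φ, h⟩
    refine h 0 (.tail (b := 2) (.tail (b := 1) (.single ?_) ?_) ?_) <;>
      exact ⟨by decide, Subsingleton.elim _ _⟩
  · intro e f hef
    refine ⟨fun _ => 0, acy_rank (fun v => (v - f).val) ?_ ?_⟩
    · rintro u v ⟨⟨h, h'⟩, -⟩
      revert e f u v
      decide
    · intro v hv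
      rw [Relation.TransGen.head'_iff] at hv
      obtain ⟨w, ⟨⟨⟨h, h'⟩, -⟩, h2⟩, -⟩ := hv
      revert e f v w
      decide

theorem tri_arcs : arcs (fun u v : Fin 3 => v = u + 1) ≤ 3 := by
  have := Nat.card_le_card_of_surjective
    (fun u : Fin 3 => (⟨(u, u + 1), rfl⟩ : {p : Fin 3 × Fin 3 // p.2 = p.1 + 1})) (by
      rintro ⟨⟨u, v⟩, h⟩
      simp only at h
      subst h
      exact ⟨u, rfl⟩)
  simpa [arcs] using this

theorem cyc_bcrit (m : ℕ) : BCrit 2 (fun i : Fin (2 * m + 3) => i) (fun i => i + 1) := by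
  have v1 : (1 : Fin (2 * m + 3)).val = 1 := by
    rfl
  refine ⟨?_, ?_, fun a b h _ => h, ?_, ?_, fun v => ⟨v, Or.inl rfl⟩⟩
  · intro a h
    have h : (1 : Fin (2 * m + 3)) = 0 := by
      have h2 : a + 1 = a + 0 := by rw [add_zero]; exact h.symm
      exact add_left_cancel h2
    have := congrArg Fin.val h
    rw [v1] at this
    simp at this
  · intro a b h1 h2
    subst h1
    have h : (1 : Fin (2 * m + 3)) + 1 = 0 := by
      rw [add_assoc] at h2
      simpa using h2
    have := congrArg Fin.val h
    rw [Fin.val_add, v1, Nat.mod_eq_of_lt (by omega)] at this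
    simp at this
  · intro φ
    by_contra hn
    push Not at hn
    have key : ∀ j : ℕ, (φ (Fin.ofNat (2 * m + 3) j)).val = ((φ 0).val + j) % 2 := by
      intro j
      induction j with
      | zero =>
        have : Fin.ofNat (2 * m + 3) 0 = 0 := rfl
        rw [this]
        have := (φ 0).isLt
        omega
      | succ j ih =>
        have h := hn (Fin.ofNat (2 * m + 3) j)
        have e : Fin.ofNat (2 * m + 3) j + 1 = Fin.ofNat (2 * m + 3) (j + 1) := by
          ext
          rw [Fin.val_add, v1]
          simp [Fin.ofNat]
        rw [e, Ne, Fin.ext_iff] at h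
        have := (φ (Fin.ofNat (2 * m + 3) (j + 1))).isLt
        omega
    have := key (2 * m + 3)
    have e : Fin.ofNat (2 * m + 3) (2 * m + 3) = 0 := by ext; simp [Fin.ofNat]
    rw [e] at this
    omega
  · intro a
    refine ⟨fun j => ⟨(j - (a + 1)).val % 2, by omega⟩, ?_⟩
    intro b hb h
    simp only [Fin.mk.injEq] at h
    have e : b + 1 - (a + 1) = (b - (a + 1)) + 1 := by abel
    rw [e, Fin.val_add_one, if_neg] at h
    · omega
    · intro h
      apply hb
      have h2 : (b - (a + 1)) + 1 = 0 := by rw [h]; exact Fin.last_add_one _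
      have h3 : b - a = 0 := by rw [← h2]; abel
      exact sub_eq_zero.1 h3

theorem tour_bcrit (k : ℕ) (hk : 2 ≤ k) : BCrit k (fun p : {p : Fin (k+1) × Fin (k+1) // p.1 < p.2} => p.1.1)
    (fun p => p.1.2) := by
  refine ⟨fun a => a.2.ne, ?_, ?_, ?_, ?_, ?_⟩
  · rintro ⟨⟨a, b⟩, h⟩ ⟨⟨c, d⟩, h'⟩ h1 h2
    simp only at *
    subst h1 h2
    exact lt_asymm h h'
  · rintro ⟨⟨a, b⟩, h⟩ ⟨⟨c, d⟩, h'⟩ h1 h2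
    simp only at *
    subst h1 h2
    rfl
  · intro φ
    obtain ⟨x, y, hne, h⟩ := Fintype.exists_ne_map_eq_of_card_lt φ (by simp)
    rcases lt_or_gt_of_ne hne with hlt | hlt
    · exact ⟨⟨(x, y), hlt⟩, h⟩
    · exact ⟨⟨(y, x), hlt⟩, h.symm⟩
  · rintro ⟨⟨x, y⟩, hxy⟩
    -- merge y with x
    simp only at hxy
    have : ∀ v, ∃ z : Fin k, y.succAbove z = if v = y then x else v := by
      intro v
      apply Fin.exists_succAbove_eq
      split_ifs with h
      · exact hxy.ne
      · exact h
    choose φ hφ using this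
    refine ⟨φ, ?_⟩
    rintro ⟨⟨u, v⟩, huv⟩ hne h
    simp only at huv h
    have h1 := hφ u
    rw [h, hφ v] at h1
    apply hne
    split_ifs at h1 with h2 h3 h3
    · exact absurd (h3.trans h2.symm) huv.ne
    · subst h2; subst h1; rfl
    · subst h3; subst h1; exact absurd huv (lt_asymm hxy)
    · exact absurd h1.symm huv.ne
  · intro v
    by_cases h : v = 0
    · refine ⟨⟨(v, Fin.last k), ?_⟩, Or.inl rfl⟩
      subst h
      simp [Fin.lt_def]
      omega
    · exact ⟨⟨(0, v), Fin.pos_of_ne_zero h⟩, Or.inr rfl⟩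

theorem exists_crit (n0 j : ℕ) : ∃ (V : Type) (_ : Finite V) (R : V → V → Prop), Crit (j + 2) R ∧
    n0 ≤ Nat.card V ∧ (arcs R : ℝ) ≤ (2 * ((j : ℝ) + 3) - 7/2) * (Nat.card V : ℝ) := by
  induction j with
  | zero =>
    refine ⟨_, inferInstance, _, big_crit (cyc_bcrit n0) tri_crit, ?_, ?_⟩
    · simp only [Nat.card_sum, Nat.card_prod, Nat.card_fin]; omega
    · have h := big_arcs (fun i : Fin (2 * n0 + 3) => i) (fun i => i + 1)
        (fun u v : Fin 3 => v = u + 1)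
      have h2 := tri_arcs
      have h3 : arcs (Big (fun i : Fin (2 * n0 + 3) => i) (fun i => i + 1)
        (fun u v : Fin 3 => v = u + 1)) ≤ (2 * n0 + 3) * 10 := by
        refine h.trans ?_
        simp only [Nat.card_fin]
        exact Nat.mul_le_mul_left _ (by omega)
      have h4 : (arcs (Big (fun i : Fin (2 * n0 + 3) => i) (fun i => i + 1)
        (fun u v : Fin 3 => v = u + 1)) : ℝ) ≤ (2 * n0 + 3) * 10 := by exact_mod_cast h3
      simp only [Nat.card_sum, Nat.card_prod, Nat.card_fin]
      push_cast
      linarith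
  | succ j ih =>
    obtain ⟨W, _, R, hR, hn, ha⟩ := ih
    have B := tour_bcrit (j + 3) (by omega)
    refine ⟨_, inferInstance, _, big_crit B hR, ?_, ?_⟩
    · simp only [Nat.card_sum, Nat.card_prod, Nat.card_fin]
      have : 0 < Nat.card {p : Fin (j+3+1) × Fin (j+3+1) // p.1 < p.2} := by
        obtain ⟨a, -⟩ := B.inc 0
        have : Nonempty {p : Fin (j+3+1) × Fin (j+3+1) // p.1 < p.2} := ⟨a⟩
        exact Nat.card_pos
      nlinarith
    · have h := big_arcs (fun p : {p : Fin (j+3+1) × Fin (j+3+1) // p.1 < p.2} => p.1.1)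
        (fun p => p.1.2) R
      have hA : Nat.card {p : Fin (j+3+1) × Fin (j+3+1) // p.1 < p.2} ≤ (j+4) * (j+4) := by
        have := Nat.card_le_card_of_injective
          (Subtype.val : {p : Fin (j+3+1) × Fin (j+3+1) // p.1 < p.2} → _) Subtype.val_injective
        simpa using this
      have h' : (arcs (Big (fun p : {p : Fin (j+3+1) × Fin (j+3+1) // p.1 < p.2} => p.1.1)
        (fun p => p.1.2) R) : ℝ) ≤ Nat.card {p : Fin (j+3+1) × Fin (j+3+1) // p.1 < p.2} *
          (1 + arcs R + 2 * Nat.card W) := by exact_mod_cast h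
      have hA' : (Nat.card {p : Fin (j+3+1) × Fin (j+3+1) // p.1 < p.2} : ℝ) ≤ (j+4) * (j+4) := by
        exact_mod_cast hA
      refine h'.trans ?_
      simp only [Nat.card_sum, Nat.card_prod, Nat.card_fin]
      push_cast
      have ha0 : (0 : ℝ) ≤ Nat.card {p : Fin (j+3+1) × Fin (j+3+1) // p.1 < p.2} :=
        Nat.cast_nonneg _
      generalize (Nat.card {p : Fin (j+3+1) × Fin (j+3+1) // p.1 < p.2} : ℝ) = a at *
      have := mul_le_mul_of_nonneg_left ha ha0
      have hj : (0 : ℝ) ≤ j := Nat.cast_nonneg j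
      nlinarith

theorem transfer {V : Type} [Finite V] {q : ℕ} {R : V → V → Prop} (H : Crit q R) :
    ∃ D : Dgr, D.Oriented ∧ Dgr.Dicritical (q+1) D ∧ D.nV = Nat.card V ∧ D.nA = arcs R := by
  classical
  have := Fintype.ofFinite V
  have := H.ne
  let e : V → ℕ := fun v => (Finite.equivFin V v).val
  have he : Function.Injective e := fun u v h => (Finite.equivFin V).injective (Fin.ext h)
  let f : ℕ → V := Function.invFun e
  have hf : ∀ v, f (e v) = v := Function.leftInverse_invFun he
  let D : Dgr := {
    verts := Finset.univ.image e
    Adj := fun a b => ∃ u v, R u v ∧ e u = a ∧ e v = b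
    adj_mem := by
      rintro a b ⟨u, v, -, rfl, rfl⟩
      simp
    adj_irrefl := by
      rintro a ⟨u, v, h, rfl, h2⟩
      have := he h2
      subst this
      exact H.ori _ _ h h }
  have hD : ∀ a b, D.Adj a b ↔ ∃ u v, R u v ∧ e u = a ∧ e v = b := fun _ _ => Iff.rfl
  -- colouring transfer
  have colD : ∀ (E : Dgr) (S : V → V → Prop) (k : ℕ),
      (∀ a b, E.Adj a b → S (f a) (f b)) → Col k S → E.Dicolourable k := by
    rintro E S k hE ⟨φ, hφ⟩
    refine ⟨fun a => φ (f a), fun a ha => hφ (f a) (Relation.TransGen.lift f ?_ _ _ ha)⟩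
    rintro x y ⟨h, h'⟩
    exact ⟨hE _ _ h, h'⟩
  have hlt : ∀ k ≤ q, ¬ D.Dicolourable k := by
    rintro k hk ⟨φ, hφ⟩
    refine H.ncol ⟨fun v => Fin.castLE hk (φ (e v)), fun v hv =>
      hφ (e v) (Relation.TransGen.lift e ?_ _ _ hv)⟩
    rintro x y ⟨h, h'⟩
    exact ⟨⟨x, y, h, rfl, rfl⟩, Fin.castLE_injective hk h'⟩
  refine ⟨D, ?_, ⟨?_, ?_⟩, ?_, ?_⟩
  · rintro a b ⟨u, v, h, rfl, rfl⟩ ⟨u', v', h', h1, h2⟩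
    have := he h1
    have := he h2
    subst u' v'
    exact H.ori _ _ h h'
  · have hmem : D.Dicolourable (q+1) := by
      obtain ⟨v⟩ := H.ne
      obtain ⟨ψ, hψ, -⟩ := H.one v 0
      refine colD D R _ ?_ ⟨ψ, hψ⟩
      rintro a b ⟨u, v, h, rfl, rfl⟩
      rwa [hf, hf]
    apply le_antisymm
    · exact Nat.sInf_le hmem
    · refine le_csInf ⟨_, hmem⟩ fun k hk => ?_
      by_contra hn
      exact hlt k (by omega) hk
  · rintro E ⟨⟨hv, hE⟩, hn⟩
    refine Nat.lt_succ_of_le (Nat.sInf_le ?_)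
    obtain ⟨u, v, huv, hnE⟩ : ∃ u v, R u v ∧ ¬ E.Adj (e u) (e v) := by
      by_contra hcon
      push Not at hcon
      apply hn
      refine ⟨?_, ?_⟩
      · intro a ha
        obtain ⟨v, -, rfl⟩ := Finset.mem_image.1 ha
        obtain ⟨u, h | h⟩ := H.inc v
        · exact (E.adj_mem (hcon _ _ h)).2
        · exact (E.adj_mem (hcon _ _ h)).1
      · rintro a b ⟨u, v, h, rfl, rfl⟩
        exact hcon _ _ h
    refine colD E _ q ?_ (H.del u v huv)
    intro a b hab
    obtain ⟨x, y, hxy, rfl, rfl⟩ := hE hab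
    rw [hf, hf]
    refine ⟨hxy, ?_⟩
    rintro ⟨rfl, rfl⟩
    exact hnE hab
  · change (Finset.univ.image e).card = _
    rw [Finset.card_image_of_injective _ he, Nat.card_eq_fintype_card, Finset.card_univ]
  · have : {p : ℕ × ℕ | D.Adj p.1 p.2} = Set.image (Prod.map e e) {p : V × V | R p.1 p.2} := by
      ext ⟨a, b⟩
      simp [hD]
    unfold Dgr.nA
    rw [this, Set.ncard_image_of_injective _ (he.prodMap he)]
    rfl

end Dcr

/-- for every `k ≥ 3` and every `n0`, there is a `k`-dicritical
oriented graph on `n ≥ n0` vertices with at most `(2k − 7/2)n` arcs. -/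
theorem stmt_18 (k : ℕ) (hk : 3 ≤ k) (n0 : ℕ) :
    ∃ D : Dgr, D.Oriented ∧ Dgr.Dicritical k D ∧ n0 ≤ D.nV ∧
      (D.nA : ℝ) ≤ (2 * (k : ℝ) - 7/2) * (D.nV : ℝ) := by
  obtain ⟨j, rfl⟩ : ∃ j, k = j + 3 := ⟨k - 3, by omega⟩
  obtain ⟨V, _, R, hR, hn, ha⟩ := Dcr.exists_crit n0 j
  obtain ⟨D, h1, h2, h3, h4⟩ := Dcr.transfer hR
  refine ⟨D, h1, h2, by omega, ?_⟩
  rw [h3, h4]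
  push_cast
  exact ha
end
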